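/- arXiv:1409.4049 — 10 statements merged into one kernel-verified Lean document; each statement's English description precedes it below -/
import Mathlib

section
/- Let n ≥ 1, let λ > 0 and let t ∈ ℝ with −λ < t < λ. A 2n×2n complex Hermitian matrix x has characteristic polynomial (X−λ)ⁿ·(X+λ)ⁿ and leading principal n×n submatrix with characteristic polynomial (X−t)ⁿ if and only if there exists A ∈ U(n) such that x is the block matrix [[t·Iₙ, √(λ²−t²)·Aᴴ], [√(λ²−t²)·A, −t·Iₙ]]. In particular, in this case the leading principal n×n submatrix equals t·Iₙ, and the map A ↦ x is a bijection from U(n) onto this set of matrices. -/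
open Polynomial Matrix

open scoped ComplexOrder in
/-- A Hermitian nilpotent matrix over `ℂ` vanishes. -/
theorem Matrix.IsHermitian.eq_zero_of_pow_eq_zero {m : Type*} [Fintype m] [DecidableEq m]
    {N : Matrix m m ℂ} (hN : N.IsHermitian) {k : ℕ} (h : N ^ k = 0) : N = 0 := by
  have descend : ∀ j : ℕ, N ^ 2 ^ j = 0 → N = 0 := by
    intro j
    induction j with
    | zero => simp
    | succ j ih =>
      intro h
      apply ih
      rw [← Matrix.conjTranspose_mul_self_eq_zero, (hN.pow (2 ^ j)).eq, ← pow_add,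
        ← two_mul, ← pow_succ', h]
  exact descend k (pow_eq_zero_of_le Nat.lt_two_pow_self.le h)

theorem Matrix.IsHermitian.eq_smul_one_of_charpoly_eq {m : Type*} [Fintype m] [DecidableEq m]
    {M : Matrix m m ℂ} (hM : M.IsHermitian) {t : ℝ} {k : ℕ}
    (h : M.charpoly = (X - C (t : ℂ)) ^ k) : M = (t : ℂ) • 1 := by
  have hpow := M.aeval_self_charpoly
  rw [h] at hpow
  simp only [map_pow, map_sub, aeval_X, aeval_C, Algebra.algebraMap_eq_smul_one] at hpow
  refine sub_eq_zero.mp (Matrix.IsHermitian.eq_zero_of_pow_eq_zero ?_ hpow)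
  exact hM.sub (by simp [Matrix.IsHermitian, Matrix.conjTranspose_smul])

theorem Matrix.IsHermitian.mul_self_eq_of_charpoly_eq {m : Type*} [Fintype m] [DecidableEq m]
    {M : Matrix m m ℂ} (hM : M.IsHermitian) {lam : ℝ} {k : ℕ}
    (h : M.charpoly = (X - C (lam : ℂ)) ^ k * (X + C (lam : ℂ)) ^ k) :
    M * M = ((lam : ℂ) ^ 2) • 1 := by
  have hpow := M.aeval_self_charpoly
  have hprod : (X - C (lam : ℂ)) * (X + C (lam : ℂ)) = X * X - C ((lam : ℂ) ^ 2) := by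
    rw [C_pow]; ring
  rw [h, ← mul_pow, hprod] at hpow
  simp only [map_pow _ (_ - _), map_sub, map_mul, aeval_X, aeval_C,
    Algebra.algebraMap_eq_smul_one] at hpow
  refine sub_eq_zero.mp (Matrix.IsHermitian.eq_zero_of_pow_eq_zero ?_ hpow)
  exact Matrix.IsHermitian.sub (by simp [Matrix.IsHermitian, hM.eq])
    (by simp [Matrix.IsHermitian, Matrix.conjTranspose_smul])

/-- The determinant of a `2 × 2` block matrix with scalar diagonal blocks. -/
theorem Matrix.det_fromBlocks_smul_one {m R : Type*} [Fintype m] [DecidableEq m] [CommRing R]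
    [IsDomain R] (a : R) {b : R} (hb : b ≠ 0) (B C : Matrix m m R) :
    (fromBlocks (a • 1) B C (b • 1)).det = ((a * b) • 1 - B * C).det := by
  have hmul : fromBlocks (a • 1) B C (b • 1) * fromBlocks (b • 1) 0 (-C) 1 =
      fromBlocks ((a * b) • 1 - B * C) B 0 (b • 1) := by
    simp [fromBlocks_multiply, smul_smul, sub_eq_add_neg, mul_comm]
  have hdet := congrArg det hmul
  rw [det_mul, det_fromBlocks_zero₁₂, det_fromBlocks_zero₂₁, det_one, mul_one] at hdet
  refine mul_right_cancel₀ ?_ hdet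
  simp [hb]

theorem Matrix.charpoly_smul_one {m R : Type*} [Fintype m] [DecidableEq m] [CommRing R] (r : R) :
    (r • (1 : Matrix m m R)).charpoly = (X - C r) ^ Fintype.card m := by
  rw [smul_one_eq_diagonal, charpoly_diagonal]
  simp

theorem Matrix.charpoly_fromBlocks_unitary {m : Type*} [Fintype m] [DecidableEq m]
    {lam t s : ℂ} (hs : s ^ 2 = lam ^ 2 - t ^ 2) {A : Matrix m m ℂ} (hA : Aᴴ * A = 1) :
    (fromBlocks (t • 1) (s • Aᴴ) (s • A) (-t • 1)).charpoly =
      (X - C lam) ^ Fintype.card m * (X + C lam) ^ Fintype.card m := by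
  have hscalar (r : ℂ) : charmatrix (r • (1 : Matrix m m ℂ)) = (X - C r) • 1 := by
    rw [smul_one_eq_diagonal, charmatrix_diagonal, smul_one_eq_diagonal]
  have hprod : (s • Aᴴ).map C * (s • A).map C = C (s ^ 2) • (1 : Matrix m m ℂ[X]) := by
    rw [← Matrix.map_mul, smul_mul_smul_comm, hA, smul_one_eq_diagonal, smul_one_eq_diagonal,
      diagonal_map (map_zero C), sq]
  rw [charpoly, charmatrix_fromBlocks, hscalar, hscalar,
    det_fromBlocks_smul_one _ (X_sub_C_ne_zero _), neg_mul_neg, hprod, ← sub_smul, det_smul,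
    det_one, mul_one, ← mul_pow, hs]
  congr 1
  simp only [map_neg, map_sub, map_pow]
  ring

/-- A Hermitian square root of `lam²` with upper left block `t` is parametrized by a unitary. -/
theorem Matrix.exists_unitary_fromBlocks_of_mul_self {m : Type*} [Fintype m] [DecidableEq m]
    {lam t s : ℝ} (hs : s ^ 2 = lam ^ 2 - t ^ 2) (hs0 : s ≠ 0) {x : Matrix (m ⊕ m) (m ⊕ m) ℂ}
    (hx : x.IsHermitian) (hsq : x * x = ((lam : ℂ) ^ 2) • 1)
    (h₁₁ : x.toBlocks₁₁ = (t : ℂ) • 1) :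
    ∃ A ∈ unitaryGroup m ℂ,
      x = fromBlocks ((t : ℂ) • 1) ((s : ℂ) • Aᴴ) ((s : ℂ) • A) ((-t : ℂ) • 1) := by
  have hsC : (s : ℂ) ≠ 0 := by exact_mod_cast hs0
  have hsC2 : (s : ℂ) ^ 2 = (lam : ℂ) ^ 2 - (t : ℂ) ^ 2 := by exact_mod_cast hs
  set c := x.toBlocks₂₁ with hc
  set d := x.toBlocks₂₂ with hd
  have h₁₂ : x.toBlocks₁₂ = cᴴ := by
    ext i j
    exact (hx.apply _ _).symm
  have hblocks : x = fromBlocks ((t : ℂ) • 1) cᴴ c d := by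
    rw [← h₁₁, ← h₁₂, hc, hd, fromBlocks_toBlocks]
  rw [hblocks, fromBlocks_multiply, ← fromBlocks_one, fromBlocks_smul, fromBlocks_inj] at hsq
  obtain ⟨e₁₁, -, e₂₁, -⟩ := hsq
  have hcc : cᴴ * c = ((s : ℂ) ^ 2) • 1 := by
    rw [hsC2, sub_smul, ← e₁₁, smul_mul_smul_comm, mul_one, ← sq, add_sub_cancel_left]
  have hA : ((s : ℂ)⁻¹ • c)ᴴ * ((s : ℂ)⁻¹ • c) = 1 := by
    rw [conjTranspose_smul, smul_mul_smul_comm, hcc, smul_smul, star_inv₀,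
      Complex.star_def, Complex.conj_ofReal, ← sq, ← mul_pow, inv_mul_cancel₀ hsC, one_pow, one_smul]
  have hA' := mul_eq_one_comm.mp hA
  have hdA : d = (-t : ℂ) • 1 := by
    have hdc : d * c = (-t : ℂ) • c := by
      rw [smul_zero, mul_smul_comm, mul_one] at e₂₁
      rw [neg_smul]
      exact eq_neg_of_add_eq_zero_right e₂₁
    calc d = d * (((s : ℂ)⁻¹ • c) * ((s : ℂ)⁻¹ • c)ᴴ) := by rw [hA', mul_one]
      _ = (-t : ℂ) • (((s : ℂ)⁻¹ • c) * ((s : ℂ)⁻¹ • c)ᴴ) := by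
        rw [← mul_assoc, mul_smul_comm, hdc, smul_comm, smul_mul_assoc]
      _ = (-t : ℂ) • 1 := by rw [hA']
  refine ⟨(s : ℂ)⁻¹ • c, mem_unitaryGroup_iff'.mpr hA, ?_⟩
  rw [hblocks, hdA]
  simp [conjTranspose_smul, smul_smul, hsC]

/-- The fiber `L_t` of the Gelfand–Cetlin system on `Gr(n,2n)`: a Hermitian `2n×2n` matrix
has characteristic polynomial `(X−λ)ⁿ(X+λ)ⁿ` and leading principal `n×n` block with
characteristic polynomial `(X−t)ⁿ` iff it is of the block form `[[tI, √(λ²−t²)Aᴴ],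
[√(λ²−t²)A, −tI]]` for a unitary `A`; in that case the leading block is `tI`, and the
parametrization by `U(n)` is injective. -/
theorem stmt4 (n : ℕ) (hn : 1 ≤ n) (lam t : ℝ) (hlam : 0 < lam)
    (ht : -lam < t) (ht' : t < lam)
    (x : Matrix (Fin n ⊕ Fin n) (Fin n ⊕ Fin n) ℂ) (hx : x.IsHermitian) :
    (x.charpoly = (X - C (lam : ℂ)) ^ n * (X + C (lam : ℂ)) ^ n ∧
        (x.toBlocks₁₁).charpoly = (X - C (t : ℂ)) ^ n ↔
      ∃ A ∈ Matrix.unitaryGroup (Fin n) ℂ,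
        x = Matrix.fromBlocks ((t : ℂ) • 1)
              ((Real.sqrt (lam ^ 2 - t ^ 2) : ℂ) • Aᴴ)
              ((Real.sqrt (lam ^ 2 - t ^ 2) : ℂ) • A) ((-t : ℂ) • 1)) ∧
    ((∃ A ∈ Matrix.unitaryGroup (Fin n) ℂ,
        x = Matrix.fromBlocks ((t : ℂ) • 1)
              ((Real.sqrt (lam ^ 2 - t ^ 2) : ℂ) • Aᴴ)
              ((Real.sqrt (lam ^ 2 - t ^ 2) : ℂ) • A) ((-t : ℂ) • 1)) →
      x.toBlocks₁₁ = (t : ℂ) • 1) ∧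
    (∀ A B : Matrix (Fin n) (Fin n) ℂ,
      A ∈ Matrix.unitaryGroup (Fin n) ℂ → B ∈ Matrix.unitaryGroup (Fin n) ℂ →
      Matrix.fromBlocks ((t : ℂ) • 1) ((Real.sqrt (lam ^ 2 - t ^ 2) : ℂ) • Aᴴ)
          ((Real.sqrt (lam ^ 2 - t ^ 2) : ℂ) • A) ((-t : ℂ) • 1) =
        Matrix.fromBlocks ((t : ℂ) • 1) ((Real.sqrt (lam ^ 2 - t ^ 2) : ℂ) • Bᴴ)
          ((Real.sqrt (lam ^ 2 - t ^ 2) : ℂ) • B) ((-t : ℂ) • 1) →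
      A = B) := by
  have hpos : 0 < lam ^ 2 - t ^ 2 := by nlinarith
  have hs0 : Real.sqrt (lam ^ 2 - t ^ 2) ≠ 0 := (Real.sqrt_pos.mpr hpos).ne'
  have hs : Real.sqrt (lam ^ 2 - t ^ 2) ^ 2 = lam ^ 2 - t ^ 2 := Real.sq_sqrt hpos.le
  refine ⟨⟨?_, ?_⟩, ?_, ?_⟩
  · rintro ⟨hchar, hchar₁₁⟩
    refine Matrix.exists_unitary_fromBlocks_of_mul_self hs hs0 hx
      (hx.mul_self_eq_of_charpoly_eq hchar) ?_
    exact Matrix.IsHermitian.eq_smul_one_of_charpoly_eq (hx.submatrix Sum.inl) hchar₁₁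
  · rintro ⟨A, hA, rfl⟩
    refine ⟨?_, ?_⟩
    · rw [Matrix.charpoly_fromBlocks_unitary (lam := (lam : ℂ)) (by exact_mod_cast hs)
        (Matrix.mem_unitaryGroup_iff'.mp hA), Fintype.card_fin]
    · rw [Matrix.toBlocks_fromBlocks₁₁, Matrix.charpoly_smul_one, Fintype.card_fin]
  · rintro ⟨A, -, rfl⟩
    exact Matrix.toBlocks_fromBlocks₁₁ _ _ _ _
  · intro A B _ _ hAB
    exact smul_right_injective _ (Complex.ofReal_ne_zero.mpr hs0) (Matrix.fromBlocks_inj.mp hAB).2.2.1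
end

section
/- Let n ≥ 1, λ > 0, t ∈ (−λ, λ), and let L_t denote the set of 2n×2n complex matrices of the form [[t·Iₙ, √(λ²−t²)·Aᴴ], [√(λ²−t²)·A, −t·Iₙ]] with A ∈ U(n). Let g be the 2n×2n block matrix [[0, −Iₙ], [Iₙ, 0]] (an element of U(2n)). Then g·L_t·gᴴ = L_{−t}. In particular, for t ≠ 0, L_t ∩ g·L_t·gᴴ = ∅. -/
open Matrix

/-- The Lagrangian `U(n)`-fiber `L_t` of the Gelfand–Cetlin system on `Gr(n,2n)`. -/
def GCfiber (n : ℕ) (lam t : ℝ) : Set (Matrix (Fin n ⊕ Fin n) (Fin n ⊕ Fin n) ℂ) :=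
  {x | ∃ A ∈ Matrix.unitaryGroup (Fin n) ℂ,
    x = Matrix.fromBlocks ((t : ℂ) • 1) ((Real.sqrt (lam ^ 2 - t ^ 2) : ℂ) • Aᴴ)
          ((Real.sqrt (lam ^ 2 - t ^ 2) : ℂ) • A) ((-t : ℂ) • 1)}

theorem fromBlocks_conj_rotation {m R : Type*} [Fintype m] [DecidableEq m] [Ring R] [StarRing R]
    (a b c d : Matrix m m R) :
    fromBlocks (0 : Matrix m m R) (-1) 1 0 * fromBlocks a b c d *
      (fromBlocks (0 : Matrix m m R) (-1) 1 0)ᴴ = fromBlocks d (-c) (-b) a := by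
  simp [fromBlocks_conjTranspose, fromBlocks_multiply]

theorem image_conj_rotation_GCfiber (n : ℕ) (lam t : ℝ) :
    (fun x : Matrix (Fin n ⊕ Fin n) (Fin n ⊕ Fin n) ℂ =>
        fromBlocks (0 : Matrix (Fin n) (Fin n) ℂ) (-1) 1 0 * x *
          (fromBlocks (0 : Matrix (Fin n) (Fin n) ℂ) (-1) 1 0)ᴴ) ''
        GCfiber n lam t = GCfiber n lam (-t) := by
  have hneg : ∀ A ∈ unitaryGroup (Fin n) ℂ, -Aᴴ ∈ unitaryGroup (Fin n) ℂ := fun A hA => by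
    rw [← star_eq_conjTranspose]
    exact (-(star (⟨A, hA⟩ : unitaryGroup (Fin n) ℂ))).2
  ext x
  constructor
  · rintro ⟨_, ⟨A, hA, rfl⟩, rfl⟩
    refine ⟨-Aᴴ, hneg A hA, ?_⟩
    simp [fromBlocks_conj_rotation]
  · rintro ⟨A, hA, rfl⟩
    refine ⟨_, ⟨-Aᴴ, hneg A hA, rfl⟩, ?_⟩
    simp [fromBlocks_conj_rotation]

theorem disjoint_GCfiber {n : ℕ} (hn : 1 ≤ n) (lam : ℝ) {s t : ℝ} (hst : s ≠ t) :
    Disjoint (GCfiber n lam s) (GCfiber n lam t) := by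
  rw [Set.disjoint_left]
  rintro _ ⟨A, -, rfl⟩ ⟨B, -, h⟩
  have h₀ := congrFun₂ h (Sum.inl ⟨0, hn⟩) (Sum.inl ⟨0, hn⟩)
  simp at h₀
  exact hst h₀

/-- Conjugation by the unitary block matrix `g = [[0,−I],[I,0]]` carries `L_t` to `L_{−t}`;
in particular `L_t` is displaced from itself for `t ≠ 0`. -/
theorem stmt5 (n : ℕ) (hn : 1 ≤ n) (lam t : ℝ) (hlam : 0 < lam)
    (ht : -lam < t) (ht' : t < lam) :
    (fun x : Matrix (Fin n ⊕ Fin n) (Fin n ⊕ Fin n) ℂ =>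
        Matrix.fromBlocks (0 : Matrix (Fin n) (Fin n) ℂ) (-1) 1 0 * x *
          (Matrix.fromBlocks (0 : Matrix (Fin n) (Fin n) ℂ) (-1) 1 0)ᴴ) ''
        GCfiber n lam t = GCfiber n lam (-t) ∧
    (t ≠ 0 →
      GCfiber n lam t ∩
        ((fun x : Matrix (Fin n ⊕ Fin n) (Fin n ⊕ Fin n) ℂ =>
          Matrix.fromBlocks (0 : Matrix (Fin n) (Fin n) ℂ) (-1) 1 0 * x *
            (Matrix.fromBlocks (0 : Matrix (Fin n) (Fin n) ℂ) (-1) 1 0)ᴴ) ''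
          GCfiber n lam t) = ∅) := by
  rw [image_conj_rotation_GCfiber]
  exact ⟨rfl, fun h => (disjoint_GCfiber hn lam (self_ne_neg.mpr h)).inter_eq⟩
end

section
/- Let n ≥ 1, let A be an n×n complex unitary matrix, and let c ∈ ℂ with Im(c) ≠ 0. Then the following are equivalent: (i) for every x ∈ ℝ, the matrix (1/(x − conj(c)))·(x·Iₙ − conj(c)·A) is unitary; (ii) conj(c)·A + c·Aᴴ = (c + conj(c))·Iₙ. -/
open Matrix

/-- The Gram matrix of `x·I − conj(c)·A` for unitary `A` and real `x`. -/
theorem smul_one_sub_smul_mul_conjTranspose {m : Type*} [Fintype m] [DecidableEq m]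
    {A : Matrix m m ℂ} (hA : A * Aᴴ = 1) (c : ℂ) (x : ℝ) :
    ((x : ℂ) • (1 : Matrix m m ℂ) - (starRingEnd ℂ) c • A) *
        ((x : ℂ) • (1 : Matrix m m ℂ) - (starRingEnd ℂ) c • A)ᴴ =
      (((x : ℂ) - (starRingEnd ℂ) c) * ((x : ℂ) - c)) • (1 : Matrix m m ℂ) -
        (x : ℂ) • ((starRingEnd ℂ) c • A + c • Aᴴ -
          (c + (starRingEnd ℂ) c) • (1 : Matrix m m ℂ)) := by
  simp only [conjTranspose_sub, conjTranspose_smul, conjTranspose_one, sub_mul, mul_sub,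
    smul_mul_assoc, mul_smul_comm, one_mul, mul_one, hA, RCLike.star_def, Complex.conj_ofReal,
    Complex.conj_conj]
  module

/-- The Lagrangian boundary condition for degree-one holomorphic curves in `Gr(n,2n)`:
`(x·I − conj(c)·A)/(x − conj c)` is unitary for every real `x` iff
`conj(c)A + cAᴴ = (c + conj c)·I`. -/
theorem stmt8 (n : ℕ) (hn : 1 ≤ n) (A : Matrix (Fin n) (Fin n) ℂ)
    (hA : A ∈ Matrix.unitaryGroup (Fin n) ℂ) (c : ℂ) (hc : c.im ≠ 0) :
    (∀ x : ℝ, ((x : ℂ) - (starRingEnd ℂ) c)⁻¹ •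
        ((x : ℂ) • (1 : Matrix (Fin n) (Fin n) ℂ) - (starRingEnd ℂ) c • A) ∈
        Matrix.unitaryGroup (Fin n) ℂ) ↔
    (starRingEnd ℂ) c • A + c • Aᴴ =
      (c + (starRingEnd ℂ) c) • (1 : Matrix (Fin n) (Fin n) ℂ) := by
  have hne (x : ℝ) : ((x : ℂ) - (starRingEnd ℂ) c) * ((x : ℂ) - c) ≠ 0 := by
    refine mul_ne_zero (fun h => hc ?_) (fun h => hc ?_) <;>
      simpa using congrArg Complex.im h
  have unitary_iff (x : ℝ) : ((x : ℂ) - (starRingEnd ℂ) c)⁻¹ •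
        ((x : ℂ) • (1 : Matrix (Fin n) (Fin n) ℂ) - (starRingEnd ℂ) c • A) ∈
        Matrix.unitaryGroup (Fin n) ℂ ↔
      (x : ℂ) • ((starRingEnd ℂ) c • A + c • Aᴴ -
        (c + (starRingEnd ℂ) c) • (1 : Matrix (Fin n) (Fin n) ℂ)) = 0 := by
    have hstar : star ((x : ℂ) - (starRingEnd ℂ) c)⁻¹ = ((x : ℂ) - c)⁻¹ := by simp
    rw [mem_unitaryGroup_iff, star_eq_conjTranspose, conjTranspose_smul, hstar, smul_mul_smul_comm,
      smul_one_sub_smul_mul_conjTranspose (mem_unitaryGroup_iff.mp hA), ← mul_inv,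
      inv_smul_eq_iff₀ (hne x), sub_eq_self]
  simp only [unitary_iff]
  rw [← sub_eq_zero]
  exact ⟨fun h => by simpa using h 1, fun h x => by rw [h, smul_zero]⟩
end

section
/- Let Q₁, Q₂, Q₃ be nonzero complex numbers and define po: (ℂ∖{0})³ → ℂ by po(y₁,y₂,y₃) = Q₁/y₁ + y₁/Q₂ + Q₂/y₂ + y₂/Q₃ + y₁/y₃ + y₃/y₂. Then (y₁,y₂,y₃) ∈ (ℂ∖{0})³ is a critical point of po (i.e., for each i, the complex derivative in the variable yᵢ of the one-variable function obtained by fixing the other coordinates vanishes) if and only if y₃³ = Q₁Q₂Q₃, y₂² = Q₃·(y₃ + Q₂), and y₁ = y₃²/y₂. Moreover, if Q₁, Q₂, Q₃ are positive real numbers, then po has exactly six critical points in (ℂ∖{0})³. -/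
/-- The potential function of the Gelfand–Cetlin system on `Fl(3)`, as a function of
`(y₁, y₂, y₃)` (indexed by `Fin 3`) with parameters `Q₁, Q₂, Q₃`. -/
noncomputable def poFl3 (Q1 Q2 Q3 : ℂ) (y : Fin 3 → ℂ) : ℂ :=
  Q1 / y 0 + y 0 / Q2 + Q2 / y 1 + y 1 / Q3 + y 0 / y 2 + y 2 / y 1

/-- The one-variable derivative of `A / w + B * w + C` at a nonzero point. -/
theorem deriv_div_add_mul_add_const (A B C : ℂ) {x : ℂ} (hx : x ≠ 0) :
    deriv (fun w => A / w + B * w + C) x = -A / x ^ 2 + B := by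
  have h := (((hasDerivAt_inv hx).const_mul A).add ((hasDerivAt_id x).const_mul B)).add_const C
  have h' : HasDerivAt (fun w => A / w + B * w + C) (-A / x ^ 2 + B) x := by
    refine (h.congr_deriv (by field_simp)).congr_of_eventuallyEq (.of_forall fun w => ?_)
    simp [div_eq_mul_inv]
  exact h'.deriv

theorem deriv_poFl3_zero (Q1 Q2 Q3 : ℂ) {y : Fin 3 → ℂ} (h0 : y 0 ≠ 0) :
    deriv (fun w => poFl3 Q1 Q2 Q3 (Function.update y 0 w)) (y 0) =
      -Q1 / y 0 ^ 2 + (1 / Q2 + 1 / y 2) := by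
  rw [← deriv_div_add_mul_add_const Q1 _ (Q2 / y 1 + y 1 / Q3 + y 2 / y 1) h0]
  congr 1
  funext w
  simp [poFl3]
  ring

theorem deriv_poFl3_one (Q1 Q2 Q3 : ℂ) {y : Fin 3 → ℂ} (h1 : y 1 ≠ 0) :
    deriv (fun w => poFl3 Q1 Q2 Q3 (Function.update y 1 w)) (y 1) =
      -(Q2 + y 2) / y 1 ^ 2 + 1 / Q3 := by
  rw [← deriv_div_add_mul_add_const (Q2 + y 2) _ (Q1 / y 0 + y 0 / Q2 + y 0 / y 2) h1]
  congr 1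
  funext w
  simp [poFl3]
  ring

theorem deriv_poFl3_two (Q1 Q2 Q3 : ℂ) {y : Fin 3 → ℂ} (h2 : y 2 ≠ 0) :
    deriv (fun w => poFl3 Q1 Q2 Q3 (Function.update y 2 w)) (y 2) =
      -y 0 / y 2 ^ 2 + 1 / y 1 := by
  rw [← deriv_div_add_mul_add_const (y 0) _ (Q1 / y 0 + y 0 / Q2 + Q2 / y 1 + y 1 / Q3) h2]
  congr 1
  funext w
  simp [poFl3]
  ring

/-- The critical point equations of `poFl3`, in solved form. -/
theorem poFl3_critical_iff {Q1 Q2 Q3 : ℂ} (hQ2 : Q2 ≠ 0) (hQ3 : Q3 ≠ 0)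
    {y : Fin 3 → ℂ} (hy : ∀ i, y i ≠ 0) :
    (∀ i, deriv (fun w => poFl3 Q1 Q2 Q3 (Function.update y i w)) (y i) = 0) ↔
      (y 2) ^ 3 = Q1 * Q2 * Q3 ∧ (y 1) ^ 2 = Q3 * (y 2 + Q2) ∧ y 0 = (y 2) ^ 2 / y 1 := by
  have h0 := hy 0
  have h1 := hy 1
  have h2 := hy 2
  rw [Fin.forall_fin_succ, Fin.forall_fin_two]
  simp only [Fin.succ_zero_eq_one, Fin.succ_one_eq_two]
  rw [deriv_poFl3_zero _ _ _ h0, deriv_poFl3_one _ _ _ h1, deriv_poFl3_two _ _ _ h2]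
  generalize y 0 = a at *
  generalize y 1 = b at *
  generalize y 2 = c at *
  have e0 : -Q1 / a ^ 2 + (1 / Q2 + 1 / c) = 0 ↔ a ^ 2 * (c + Q2) = Q1 * Q2 * c := by
    rw [← sub_eq_zero (a := a ^ 2 * (c + Q2)),
      show -Q1 / a ^ 2 + (1 / Q2 + 1 / c) =
        (a ^ 2 * (c + Q2) - Q1 * Q2 * c) / (a ^ 2 * Q2 * c) by field_simp; ring]
    simp [h0, h2, hQ2]
  have e1 : -(Q2 + c) / b ^ 2 + 1 / Q3 = 0 ↔ b ^ 2 = Q3 * (c + Q2) := by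
    rw [← sub_eq_zero (a := b ^ 2),
      show -(Q2 + c) / b ^ 2 + 1 / Q3 = (b ^ 2 - Q3 * (c + Q2)) / (b ^ 2 * Q3) by
        field_simp; ring]
    simp [h1, hQ3]
  have e2 : -a / c ^ 2 + 1 / b = 0 ↔ a = c ^ 2 / b := by
    rw [eq_div_iff h1, ← sub_eq_zero (a := a * b),
      show -a / c ^ 2 + 1 / b = -(a * b - c ^ 2) / (c ^ 2 * b) by field_simp; ring]
    rw [div_eq_zero_iff, neg_eq_zero]
    simp [h1, h2]
  rw [e0, e1, e2]
  have key (hb : b ^ 2 = Q3 * (c + Q2)) (ha : a = c ^ 2 / b) :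
      a ^ 2 * (c + Q2) * Q3 = c ^ 4 := by
    rw [eq_div_iff h1] at ha
    linear_combination (a * b + c ^ 2) * ha - a ^ 2 * hb
  constructor
  · rintro ⟨h, hb, ha⟩
    refine ⟨mul_left_cancel₀ h2 ?_, hb, ha⟩
    linear_combination Q3 * h - key hb ha
  · rintro ⟨h, hb, ha⟩
    refine ⟨mul_right_cancel₀ hQ3 ?_, hb, ha⟩
    linear_combination key hb ha + c * h

/-- If `s ≠ 0` and `F` does not vanish at any cube root of `s ^ 3`, the system
`c ^ 3 = s ^ 3`, `b ^ 2 = F c`, `a = c ^ 2 / b` has exactly six solutions `(a, b, c)`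
with nonzero entries. -/
theorem ncard_cube_root_square_root_eq_six {s : ℂ} (hs : s ≠ 0) (F : ℂ → ℂ)
    (hF : ∀ c, c ^ 3 = s ^ 3 → F c ≠ 0) :
    Set.ncard {y : Fin 3 → ℂ | (∀ i, y i ≠ 0) ∧
      y 2 ^ 3 = s ^ 3 ∧ y 1 ^ 2 = F (y 2) ∧ y 0 = y 2 ^ 2 / y 1} = 6 := by
  have hω := Complex.isPrimitiveRoot_exp 3 (by norm_num)
  generalize Complex.exp (2 * Real.pi * Complex.I / (3 : ℕ)) = ω at hω
  choose r hr using fun z : ℂ => IsAlgClosed.exists_pow_nat_eq (F z) (n := 2) (by norm_num)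
  have hc (k : Fin 3) : (s * ω ^ (k : ℕ)) ^ 3 = s ^ 3 := by
    rw [mul_pow, pow_right_comm, hω.pow_eq_one, one_pow, mul_one]
  have hc0 (k : Fin 3) : s * ω ^ (k : ℕ) ≠ 0 := fun h => by
    have := hc k
    rw [h] at this
    exact hs (pow_eq_zero_iff (by norm_num) |>.1 (this.symm.trans (by norm_num)))
  have hr0 (k : Fin 3) : r (s * ω ^ (k : ℕ)) ≠ 0 := fun h =>
    hF _ (hc k) (by rw [← hr, h]; norm_num)
  let f : Fin 3 × ℤˣ → Fin 3 → ℂ := fun p =>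
    let c := s * ω ^ (p.1 : ℕ)
    let b := ((p.2 : ℤ) : ℂ) * r c
    ![c ^ 2 / b, b, c]
  have hf : Function.Injective f := by
    rintro ⟨k, ε⟩ ⟨l, δ⟩ h
    have h2 : s * ω ^ (k : ℕ) = s * ω ^ (l : ℕ) := congrFun h 2
    have hkl : k = l := Fin.ext (hω.pow_inj k.2 l.2 (mul_left_cancel₀ hs h2))
    subst hkl
    have h1 : ((ε : ℤ) : ℂ) * r (s * ω ^ (k : ℕ)) = ((δ : ℤ) : ℂ) * r (s * ω ^ (k : ℕ)) :=
      congrFun h 1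
    have h1' := mul_right_cancel₀ (hr0 k) h1
    rw [Int.cast_inj, Units.val_inj] at h1'
    rw [h1']
  have hunit (ε : ℤˣ) : ((ε : ℤ) : ℂ) ^ 2 = 1 := by
    rcases Int.units_eq_one_or ε with rfl | rfl <;> norm_num
  have hrange : {y : Fin 3 → ℂ | (∀ i, y i ≠ 0) ∧
      y 2 ^ 3 = s ^ 3 ∧ y 1 ^ 2 = F (y 2) ∧ y 0 = y 2 ^ 2 / y 1} = Set.range f := by
    ext y
    constructor
    · rintro ⟨-, h2, h1, h0⟩
      obtain ⟨k, hk, hk'⟩ := hω.eq_pow_of_pow_eq_one (ξ := y 2 / s)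
        (by rw [div_pow, h2, div_self (pow_ne_zero 3 hs)])
      have hy2 : s * ω ^ k = y 2 := by rw [hk']; field_simp
      have hy1 : ∃ ε : ℤˣ, ((ε : ℤ) : ℂ) * r (y 2) = y 1 := by
        rcases sq_eq_sq_iff_eq_or_eq_neg.1 (h1.trans (hr (y 2)).symm) with h | h
        · exact ⟨1, by simp [h]⟩
        · exact ⟨-1, by simp [h]⟩
      obtain ⟨ε, hε⟩ := hy1
      refine ⟨(⟨k, hk⟩, ε), ?_⟩
      simp only [f, hy2, hε, ← h0]
      ext i
      fin_cases i <;> rfl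
    · rintro ⟨⟨k, ε⟩, rfl⟩
      have hb : ((ε : ℤ) : ℂ) * r (s * ω ^ (k : ℕ)) ≠ 0 :=
        mul_ne_zero (by exact_mod_cast ε.ne_zero) (hr0 k)
      refine ⟨fun i => ?_, hc k, ?_, rfl⟩
      · fin_cases i
        · exact div_ne_zero (pow_ne_zero 2 (hc0 k)) hb
        · exact hb
        · exact hc0 k
      · change (((ε : ℤ) : ℂ) * r (s * ω ^ (k : ℕ))) ^ 2 = F (s * ω ^ (k : ℕ))
        rw [mul_pow, hunit, one_mul, hr]
  rw [hrange, ← Nat.card_coe_set_eq, Nat.card_range_of_injective hf]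
  simp

/-- A point of `(ℂ∖{0})³` with all coordinates nonzero is a critical point of the
`Fl(3)` potential function iff `y₃³ = Q₁Q₂Q₃`, `y₂² = Q₃(y₃ + Q₂)` and `y₁ = y₃²/y₂`;
for positive real parameters there are exactly six critical points. -/
theorem stmt11 (Q1 Q2 Q3 : ℂ) (hQ1 : Q1 ≠ 0) (hQ2 : Q2 ≠ 0) (hQ3 : Q3 ≠ 0) :
    (∀ y : Fin 3 → ℂ, (∀ i, y i ≠ 0) →
      ((∀ i, deriv (fun w => poFl3 Q1 Q2 Q3 (Function.update y i w)) (y i) = 0) ↔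
        (y 2) ^ 3 = Q1 * Q2 * Q3 ∧ (y 1) ^ 2 = Q3 * (y 2 + Q2) ∧
          y 0 = (y 2) ^ 2 / y 1)) ∧
    ((∃ r1 r2 r3 : ℝ, 0 < r1 ∧ 0 < r2 ∧ 0 < r3 ∧
        Q1 = (r1 : ℂ) ∧ Q2 = (r2 : ℂ) ∧ Q3 = (r3 : ℂ)) →
      Set.ncard {y : Fin 3 → ℂ | (∀ i, y i ≠ 0) ∧
        ∀ i, deriv (fun w => poFl3 Q1 Q2 Q3 (Function.update y i w)) (y i) = 0} = 6) := by
  refine ⟨fun y hy => poFl3_critical_iff hQ2 hQ3 hy, ?_⟩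
  rintro ⟨r1, r2, r3, hr1, hr2, hr3, rfl, rfl, rfl⟩
  have hr : 0 < r1 * r2 * r3 := by positivity
  obtain ⟨s, hs⟩ := IsAlgClosed.exists_pow_nat_eq ((r1 : ℂ) * r2 * r3) (n := 3) (by norm_num)
  have hs0 : s ≠ 0 := by
    rintro rfl
    exact mul_ne_zero (mul_ne_zero hQ1 hQ2) hQ3 (hs.symm.trans (by norm_num))
  rw [← ncard_cube_root_square_root_eq_six hs0 (fun c => (r3 : ℂ) * (c + r2))]
  · congr 1
    ext y
    refine and_congr_right fun hy => ?_
    rw [poFl3_critical_iff hQ2 hQ3 hy, hs]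
  · intro c hc h
    have hc' : c = -r2 := eq_neg_of_add_eq_zero_left ((mul_eq_zero.1 h).resolve_left hQ3)
    rw [hs, hc'] at hc
    have hreal : (-r2) ^ 3 = r1 * r2 * r3 := by exact_mod_cast hc
    have : 0 < r2 ^ 3 := by positivity
    linarith [neg_pow r2 3]
end

section
/- Let Q be a nonzero complex number and define po: (ℂ∖{0})⁴ → ℂ by po(y₁,y₂,y₃,y₄) = Q/y₂ + y₂/y₁ + y₁/y₃ + y₃ + y₂/y₄ + y₄/y₃. Then (y₁,y₂,y₃,y₄) is a critical point of po (all four partial complex derivatives vanish) if and only if y₃⁴ = 4Q, y₁ = y₃²/2, y₄ = y₃²/2, and y₂ = Q/y₃. Consequently po has exactly four critical points, one for each fourth root y₃ of 4Q, and the critical value at each is po = 4·y₃; in particular the set of critical values is {4y₃ : y₃⁴ = 4Q}, i.e., the four values 4√2·i^k·Q^{1/4} (k = 0,1,2,3) for any fixed fourth root Q^{1/4}. -/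
/-- The potential function of the Gelfand–Cetlin system on `Gr(2,4)`, as a function of
`(y₁, y₂, y₃, y₄)` (indexed by `Fin 4`) with parameter `Q`. -/
noncomputable def poGr24 (Q : ℂ) (y : Fin 4 → ℂ) : ℂ :=
  Q / y 1 + y 1 / y 0 + y 0 / y 2 + y 2 + y 1 / y 3 + y 3 / y 2

/-- A point with nonzero coordinates is critical for the `Gr(2,4)` potential iff it satisfies the
equations obtained by clearing denominators in the four partial derivatives. -/
theorem poGr24_critical_iff_polynomial (Q : ℂ) (y : Fin 4 → ℂ) (hy : ∀ i, y i ≠ 0) :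
    (∀ i, deriv (fun w => poGr24 Q (Function.update y i w)) (y i) = 0) ↔
      y 0 ^ 2 = y 1 * y 2 ∧ (y 0 + y 3) * y 1 ^ 2 = Q * (y 0 * y 3) ∧
        y 0 + y 3 = y 2 ^ 2 ∧ y 3 ^ 2 = y 1 * y 2 := by
  have h0 := hy 0
  have h1 := hy 1
  have h2 := hy 2
  have h3 := hy 3
  have hinv (a : ℂ) {x : ℂ} (hx : x ≠ 0) : HasDerivAt (fun w => a / w) (-a / x ^ 2) x := by
    simpa [div_eq_mul_inv] using (hasDerivAt_inv hx).const_mul a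
  have hid (a x : ℂ) : HasDerivAt (fun w => w / a) (1 / a) x := (hasDerivAt_id x).div_const a
  have d0 : deriv (fun w => poGr24 Q (Function.update y 0 w)) (y 0) =
      -y 1 / y 0 ^ 2 + 1 / y 2 := by
    have h := ((((hinv (y 1) h0).const_add (Q / y 1)).add (hid (y 2) (y 0))).add_const
      (y 2 + y 1 / y 3 + y 3 / y 2)).deriv
    rw [← h]
    congr 1
    funext w
    simp [poGr24]
    ring
  have d1 : deriv (fun w => poGr24 Q (Function.update y 1 w)) (y 1) =
      -Q / y 1 ^ 2 + 1 / y 0 + 1 / y 3 := by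
    have h := ((((hinv Q h1).add (hid (y 0) (y 1))).add (hid (y 3) (y 1))).add_const
      (y 0 / y 2 + y 2 + y 3 / y 2)).deriv
    rw [← h]
    congr 1
    funext w
    simp [poGr24]
    ring
  have d2 : deriv (fun w => poGr24 Q (Function.update y 2 w)) (y 2) =
      -y 0 / y 2 ^ 2 + 1 + -y 3 / y 2 ^ 2 := by
    have h := ((((hinv (y 0) h2).add (hasDerivAt_id (y 2))).add (hinv (y 3) h2)).add_const
      (Q / y 1 + y 1 / y 0 + y 1 / y 3)).deriv
    rw [← h]
    congr 1
    funext w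
    simp [poGr24]
    ring
  have d3 : deriv (fun w => poGr24 Q (Function.update y 3 w)) (y 3) =
      -y 1 / y 3 ^ 2 + 1 / y 2 := by
    have h := (((hinv (y 1) h3).add (hid (y 2) (y 3))).add_const
      (Q / y 1 + y 1 / y 0 + y 0 / y 2 + y 2)).deriv
    rw [← h]
    congr 1
    funext w
    simp [poGr24]
    ring
  simp only [Fin.forall_fin_succ, IsEmpty.forall_iff, and_true, Fin.succ_zero_eq_one,
    Fin.succ_one_eq_two, show (Fin.succ 2 : Fin 4) = 3 from rfl, d0, d1, d2, d3]
  have e0 : -y 1 / y 0 ^ 2 + 1 / y 2 = 0 ↔ y 0 ^ 2 = y 1 * y 2 := by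
    field_simp
    constructor <;> intro h <;> linear_combination h
  have e1 : -Q / y 1 ^ 2 + 1 / y 0 + 1 / y 3 = 0 ↔
      (y 0 + y 3) * y 1 ^ 2 = Q * (y 0 * y 3) := by
    field_simp
    constructor <;> intro h <;> linear_combination h
  have e2 : -y 0 / y 2 ^ 2 + 1 + -y 3 / y 2 ^ 2 = 0 ↔ y 0 + y 3 = y 2 ^ 2 := by
    field_simp
    constructor <;> intro h <;> linear_combination -h
  have e3 : -y 1 / y 3 ^ 2 + 1 / y 2 = 0 ↔ y 3 ^ 2 = y 1 * y 2 := by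
    field_simp
    constructor <;> intro h <;> linear_combination h
  rw [e0, e1, e2, e3]

/-- The critical points of the `Gr(2,4)` potential in terms of the coordinate `y₃`. -/
theorem poGr24_critical_iff (Q : ℂ) (y : Fin 4 → ℂ) (hy : ∀ i, y i ≠ 0) :
    (∀ i, deriv (fun w => poGr24 Q (Function.update y i w)) (y i) = 0) ↔
      (y 2) ^ 4 = 4 * Q ∧ y 0 = (y 2) ^ 2 / 2 ∧ y 3 = (y 2) ^ 2 / 2 ∧ y 1 = Q / y 2 := by
  rw [poGr24_critical_iff_polynomial Q y hy]
  have h2 := hy 2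
  constructor
  · rintro ⟨a, b, c, d⟩
    have h03 : y 0 = y 3 := by
      have h : (y 0 - y 3) * y 2 ^ 2 = 0 := by linear_combination a - d - (y 0 - y 3) * c
      exact sub_eq_zero.mp ((mul_eq_zero.mp h).resolve_right (pow_ne_zero 2 h2))
    have h0 : y 0 = y 2 ^ 2 / 2 := by linear_combination (c + h03) / 2
    have h3 : y 3 = y 2 ^ 2 / 2 := h03 ▸ h0
    have h1 : y 1 = y 2 ^ 3 / 4 := by
      rw [h0] at a
      exact mul_right_cancel₀ h2 (by linear_combination -a)
    have hQ : y 2 ^ 4 = 4 * Q := by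
      rw [h0, h1, h3] at b
      refine mul_right_cancel₀ (pow_ne_zero 4 h2) ?_
      linear_combination 16 * b
    refine ⟨hQ, h0, h3, ?_⟩
    rw [h1, eq_div_iff h2]
    linear_combination hQ / 4
  · rintro ⟨hQ, h0, h3, h1⟩
    have h1' : y 1 = y 2 ^ 3 / 4 := by
      rw [h1, div_eq_iff h2]
      linear_combination -hQ / 4
    have hQ' : Q = y 2 ^ 4 / 4 := by linear_combination -hQ / 4
    rw [h0, h1', h3, hQ']
    refine ⟨?_, ?_, ?_, ?_⟩ <;> ring

/-- A nonzero complex number has exactly `n` complex `n`-th roots. -/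
theorem Complex.ncard_setOf_pow_eq {n : ℕ} (hn : n ≠ 0) {a : ℂ} (ha : a ≠ 0) :
    {z : ℂ | z ^ n = a}.ncard = n := by
  have hζ := Complex.isPrimitiveRoot_exp n hn
  have hset : {z : ℂ | z ^ n = a} = ((Polynomial.nthRoots n a).toFinset : Set ℂ) := by
    ext z
    simp [Polynomial.mem_nthRoots (Nat.pos_of_ne_zero hn)]
  rw [hset, Set.ncard_coe_finset, Multiset.toFinset_card_of_nodup (hζ.nthRoots_nodup ha),
    hζ.card_nthRoots, if_pos (IsAlgClosed.exists_pow_nat_eq a (Nat.pos_of_ne_zero hn))]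

/-- The critical set of the `Gr(2,4)` potential is parametrized by the fourth roots of `4Q`. -/
theorem poGr24_setOf_critical_eq_image (Q : ℂ) (hQ : Q ≠ 0) :
    {y : Fin 4 → ℂ | (∀ i, y i ≠ 0) ∧
        ∀ i, deriv (fun w => poGr24 Q (Function.update y i w)) (y i) = 0} =
      (fun z => ![z ^ 2 / 2, Q / z, z, z ^ 2 / 2]) '' {z : ℂ | z ^ 4 = 4 * Q} := by
  ext y
  constructor
  · rintro ⟨hy, hc⟩
    obtain ⟨h, h0, h3, h1⟩ := (poGr24_critical_iff Q y hy).mp hc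
    refine ⟨y 2, h, ?_⟩
    funext i
    fin_cases i <;> simp [h0, h1, h3]
  · rintro ⟨z, hz : z ^ 4 = 4 * Q, rfl⟩
    have hz0 : z ≠ 0 := by
      rintro rfl
      simp [hQ] at hz
    have hy : ∀ i, ![z ^ 2 / 2, Q / z, z, z ^ 2 / 2] i ≠ 0 := by
      intro i
      fin_cases i <;> simp [hz0, hQ]
    exact ⟨hy, (poGr24_critical_iff Q _ hy).mpr (by simp [hz])⟩

/-- The value of the `Gr(2,4)` potential at a critical point. -/
theorem poGr24_eq_of_critical (Q : ℂ) (y : Fin 4 → ℂ) (hy : ∀ i, y i ≠ 0)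
    (hc : ∀ i, deriv (fun w => poGr24 Q (Function.update y i w)) (y i) = 0) :
    poGr24 Q y = 4 * y 2 := by
  obtain ⟨hQ, h0, h3, h1⟩ := (poGr24_critical_iff Q y hy).mp hc
  have h2 := hy 2
  have h1' : y 1 = y 2 ^ 3 / 4 := by
    rw [h1, div_eq_iff h2]
    linear_combination -hQ / 4
  have hQ' : Q = y 2 ^ 4 / 4 := by linear_combination -hQ / 4
  rw [poGr24, h0, h1', h3, hQ']
  field_simp
  ring

/-- Critical points of the `Gr(2,4)` potential: a point with nonzero coordinates is
critical iff `y₃⁴ = 4Q`, `y₁ = y₃²/2`, `y₄ = y₃²/2`, `y₂ = Q/y₃`; there are exactly four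
critical points, the critical value at each is `4y₃`, and the set of critical values is
`{4z : z⁴ = 4Q}`. -/
theorem stmt12 (Q : ℂ) (hQ : Q ≠ 0) :
    (∀ y : Fin 4 → ℂ, (∀ i, y i ≠ 0) →
      ((∀ i, deriv (fun w => poGr24 Q (Function.update y i w)) (y i) = 0) ↔
        (y 2) ^ 4 = 4 * Q ∧ y 0 = (y 2) ^ 2 / 2 ∧ y 3 = (y 2) ^ 2 / 2 ∧
          y 1 = Q / y 2)) ∧
    Set.ncard {y : Fin 4 → ℂ | (∀ i, y i ≠ 0) ∧
        ∀ i, deriv (fun w => poGr24 Q (Function.update y i w)) (y i) = 0} = 4 ∧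
    (∀ y : Fin 4 → ℂ, (∀ i, y i ≠ 0) →
      (∀ i, deriv (fun w => poGr24 Q (Function.update y i w)) (y i) = 0) →
      poGr24 Q y = 4 * y 2) ∧
    {v : ℂ | ∃ y : Fin 4 → ℂ, (∀ i, y i ≠ 0) ∧
        (∀ i, deriv (fun w => poGr24 Q (Function.update y i w)) (y i) = 0) ∧
        poGr24 Q y = v} =
      {v : ℂ | ∃ z : ℂ, z ^ 4 = 4 * Q ∧ v = 4 * z} := by
  refine ⟨poGr24_critical_iff Q, ?_, poGr24_eq_of_critical Q, ?_⟩
  · rw [poGr24_setOf_critical_eq_image Q hQ,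
      Set.ncard_image_of_injective _ fun a b h => congrFun h 2,
      Complex.ncard_setOf_pow_eq four_ne_zero (by simpa using hQ)]
  · ext v
    constructor
    · rintro ⟨y, hy, hc, rfl⟩
      exact ⟨y 2, ((poGr24_critical_iff Q y hy).mp hc).1, poGr24_eq_of_critical Q y hy hc⟩
    · rintro ⟨z, hz, rfl⟩
      obtain ⟨hy, hc⟩ := (poGr24_setOf_critical_eq_image Q hQ).ge ⟨z, hz, rfl⟩
      exact ⟨_, hy, hc, poGr24_eq_of_critical Q _ hy hc⟩
end

section
/- Let Q be a nonzero complex number and define po: (ℂ∖{0})⁶ → ℂ by po(y₁,…,y₆) = Q/y₂ + y₂/y₁ + y₁/y₃ + y₂/y₄ + y₄/y₃ + y₃/y₅ + y₅ + y₄/y₆ + y₆/y₅. Then (y₁,…,y₆) is a critical point of po (all six partial complex derivatives vanish) if and only if y₆⁵ = Q², y₆·y₄² + Q·y₄ − y₆⁴ = 0 (equivalently Q·y₄ = y₆·(y₆³ − y₄²)), y₅ = y₆²/y₄, y₁ = Q/y₆, y₂ = Q/y₅, and y₃ = Q/y₄. Consequently po has exactly ten critical points: five choices of y₆ with y₆⁵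 = Q², each with two choices of y₄ solving the quadratic y₆·y₄² + Q·y₄ − y₆⁴ = 0 (its discriminant is 5Q² ≠ 0). -/
/-- The potential function of the Gelfand–Cetlin system on `Gr(2,5)`, as a function of
`(y₁, …, y₆)` (indexed by `Fin 6`) with parameter `Q`. -/
noncomputable def poGr25 (Q : ℂ) (y : Fin 6 → ℂ) : ℂ :=
  Q / y 1 + y 1 / y 0 + y 0 / y 2 + y 1 / y 3 + y 3 / y 2 + y 2 / y 4 +
    y 4 + y 3 / y 5 + y 5 / y 4

theorem deriv_const_add_mul_add_div (a b c x : ℂ) (hx : x ≠ 0) :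
    deriv (fun w : ℂ => a + b * w + c / w) x = b - c / x ^ 2 := by
  have h : HasDerivAt (fun w : ℂ => a + b * w + c * w⁻¹) (b * 1 + c * -(x ^ 2)⁻¹) x :=
    (((hasDerivAt_id' x).const_mul b).const_add a).add ((hasDerivAt_inv hx).const_mul c)
  simp only [div_eq_mul_inv]
  rw [h.deriv]
  ring

/-- The six partial derivatives of the potential vanish exactly when these polynomial
relations hold. -/
theorem poGr25_deriv_eq_zero_iff (Q : ℂ) (y : Fin 6 → ℂ) (hy : ∀ i, y i ≠ 0) :
    (∀ i, deriv (fun w => poGr25 Q (Function.update y i w)) (y i) = 0) ↔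
      y 0 ^ 2 = y 1 * y 2 ∧ Q * (y 0 * y 3) = y 1 ^ 2 * (y 0 + y 3) ∧
      y 2 ^ 2 = y 4 * (y 0 + y 3) ∧ y 1 * (y 2 * y 5) = y 3 ^ 2 * (y 2 + y 5) ∧
      y 4 ^ 2 = y 2 + y 5 ∧ y 5 ^ 2 = y 3 * y 4 := by
  have h0 := hy 0
  have h1 := hy 1
  have h2 := hy 2
  have h3 := hy 3
  have h4 := hy 4
  have h5 := hy 5
  have key (i : Fin 6) (a b c : ℂ)
      (h : ∀ w, poGr25 Q (Function.update y i w) = a + b * w + c / w) :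
      deriv (fun w => poGr25 Q (Function.update y i w)) (y i) = b - c / y i ^ 2 := by
    rw [funext h, deriv_const_add_mul_add_div a b c _ (hy i)]
  have e0 := key 0 (Q / y 1 + y 1 / y 3 + y 3 / y 2 + y 2 / y 4 + y 4 + y 3 / y 5 + y 5 / y 4)
    (1 / y 2) (y 1) (fun w => by simp [poGr25]; ring)
  have e1 := key 1 (y 0 / y 2 + y 3 / y 2 + y 2 / y 4 + y 4 + y 3 / y 5 + y 5 / y 4)
    (1 / y 0 + 1 / y 3) Q (fun w => by simp [poGr25]; ring)
  have e2 := key 2 (Q / y 1 + y 1 / y 0 + y 1 / y 3 + y 4 + y 3 / y 5 + y 5 / y 4)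
    (1 / y 4) (y 0 + y 3) (fun w => by simp [poGr25]; ring)
  have e3 := key 3 (Q / y 1 + y 1 / y 0 + y 0 / y 2 + y 2 / y 4 + y 4 + y 5 / y 4)
    (1 / y 2 + 1 / y 5) (y 1) (fun w => by simp [poGr25]; ring)
  have e4 := key 4 (Q / y 1 + y 1 / y 0 + y 0 / y 2 + y 1 / y 3 + y 3 / y 2 + y 3 / y 5)
    1 (y 2 + y 5) (fun w => by simp [poGr25]; ring)
  have e5 := key 5 (Q / y 1 + y 1 / y 0 + y 0 / y 2 + y 1 / y 3 + y 3 / y 2 + y 2 / y 4 + y 4)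
    (1 / y 4) (y 3) (fun w => by simp [poGr25]; ring)
  simp only [Fin.forall_fin_succ, Fin.isValue, IsEmpty.forall_iff, and_true]
  change deriv (fun w => poGr25 Q (Function.update y 0 w)) (y 0) = 0 ∧
    deriv (fun w => poGr25 Q (Function.update y 1 w)) (y 1) = 0 ∧
    deriv (fun w => poGr25 Q (Function.update y 2 w)) (y 2) = 0 ∧
    deriv (fun w => poGr25 Q (Function.update y 3 w)) (y 3) = 0 ∧
    deriv (fun w => poGr25 Q (Function.update y 4 w)) (y 4) = 0 ∧
    deriv (fun w => poGr25 Q (Function.update y 5 w)) (y 5) = 0 ↔ _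
  rw [e0, e1, e2, e3, e4, e5]
  refine and_congr ?_ (and_congr ?_ (and_congr ?_ (and_congr ?_ (and_congr ?_ ?_)))) <;>
    rw [sub_eq_zero] <;> field_simp <;> constructor <;> intro h <;> linear_combination -h

/-- The polynomial form of the critical point equations is equivalent to the explicit
parametrization by `y 3` and `y 5`. -/
theorem poGr25_critical_relations_iff (Q : ℂ) (hQ : Q ≠ 0) (y : Fin 6 → ℂ)
    (hy : ∀ i, y i ≠ 0) :
    (y 0 ^ 2 = y 1 * y 2 ∧ Q * (y 0 * y 3) = y 1 ^ 2 * (y 0 + y 3) ∧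
      y 2 ^ 2 = y 4 * (y 0 + y 3) ∧ y 1 * (y 2 * y 5) = y 3 ^ 2 * (y 2 + y 5) ∧
      y 4 ^ 2 = y 2 + y 5 ∧ y 5 ^ 2 = y 3 * y 4) ↔
      y 5 ^ 5 = Q ^ 2 ∧ y 5 * y 3 ^ 2 + Q * y 3 - y 5 ^ 4 = 0 ∧
      y 4 = y 5 ^ 2 / y 3 ∧ y 0 = Q / y 5 ∧ y 1 = Q / y 4 ∧ y 2 = Q / y 3 := by
  have h0 := hy 0
  have h1 := hy 1
  have h2 := hy 2
  have h3 := hy 3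
  have h4 := hy 4
  have h5 := hy 5
  generalize y 0 = a at *
  generalize y 1 = b at *
  generalize y 2 = c at *
  generalize y 3 = d at *
  generalize y 4 = e at *
  generalize y 5 = f at *
  rw [eq_div_iff h3, eq_div_iff h5, eq_div_iff h4, eq_div_iff h3]
  constructor
  · rintro ⟨p0, p1, p2, p3, p4, p5⟩
    have q1 : a ^ 2 = f ^ 3 := by
      apply mul_right_cancel₀ h5
      linear_combination f * p0 + p3 - d ^ 2 * p4 - (f ^ 2 + d * e) * p5
    have q2 : Q * f ^ 2 = a ^ 3 := by
      apply mul_right_cancel₀ h0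
      linear_combination e * p1 + Q * a * p5 - b ^ 2 * p2 - (a ^ 2 + b * c) * p0
    have q3 : a * f = Q := by
      apply mul_right_cancel₀ (pow_ne_zero 2 h5)
      linear_combination -q2 - a * q1
    have q4 : f ^ 5 = Q ^ 2 := by
      linear_combination -f ^ 2 * q1 + (a * f + Q) * q3
    have r2 : c ^ 2 * d = Q * f + f ^ 2 * d := by
      linear_combination d * p2 - (a + d) * p5 + f * q3
    have r4 : c * d ^ 2 = f ^ 4 - f * d ^ 2 := by
      linear_combination -d ^ 2 * p4 - (f ^ 2 + d * e) * p5
    have q5 : c * d = Q := by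
      have hprod : (c * d - Q) * (c * d + Q + f * d) = 0 := by
        linear_combination d * r2 + f * r4 + q4
      rcases mul_eq_zero.mp hprod with h | h
      · exact sub_eq_zero.mp h
      · exfalso
        have s : Q * d = -f ^ 4 := by linear_combination d * h - r4
        have : Q * (c * d) = 0 := by
          linear_combination Q * h - f * s + q4
        exact mul_ne_zero hQ (mul_ne_zero h2 h3) this
    refine ⟨q4, ?_, by linear_combination -p5, q3, ?_, q5⟩
    · linear_combination r4 - d * q5
    · apply mul_right_cancel₀ (mul_ne_zero h2 h3)
      linear_combination -d * e * p0 - a ^ 2 * p5 + (f * a + Q) * q3 - Q * q5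
  · rintro ⟨q4, r, p5, q3, q6, q5⟩
    have q1 : a ^ 2 = f ^ 3 := by
      apply mul_right_cancel₀ (pow_ne_zero 2 h5)
      linear_combination (a * f + Q) * q3 - q4
    have p0 : a ^ 2 = b * c := by
      apply mul_right_cancel₀ (pow_ne_zero 2 h5)
      linear_combination (a * f + Q) * q3 + b * c * p5 - c * d * q6 - Q * q5
    have p4 : e ^ 2 = c + f := by
      apply mul_right_cancel₀ (pow_ne_zero 2 h3)
      linear_combination (e * d + f ^ 2) * p5 - d * q5 - r
    have p2 : c ^ 2 = e * (a + d) := by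
      apply mul_right_cancel₀ (mul_ne_zero (pow_ne_zero 2 h3) h5)
      linear_combination f * (c * d + Q) * q5 - d * f * (a + d) * p5 - d * f ^ 2 * q3 -
        f ^ 2 * r - f * q4
    refine ⟨p0, ?_, p2, ?_, p4, by linear_combination -p5⟩
    · apply mul_right_cancel₀ h4
      linear_combination Q * a * p5 + b ^ 2 * p2 + (a ^ 2 + b * c) * p0 - a ^ 2 * q1 -
        a * f ^ 2 * q3
    · linear_combination -f * p0 + f * q1 + d ^ 2 * p4 - (e * d + f ^ 2) * p5

/-- The point with `y₆ = t` and `y₄ = Q φ / t` solving the last four equations of the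
explicit parametrization. -/
noncomputable def poGr25Point (Q : ℂ) (p : ℂ × ℂ) : Fin 6 → ℂ :=
  ![Q / p.1, Q ^ 2 * p.2 / p.1 ^ 3, p.1 / p.2, Q * p.2 / p.1, p.1 ^ 3 / (Q * p.2), p.1]

theorem ncard_fifth_roots {a : ℂ} (ha : a ≠ 0) : {t : ℂ | t ^ 5 = a}.ncard = 5 := by
  have hζ := Complex.isPrimitiveRoot_exp 5 (by norm_num)
  have hset : {t : ℂ | t ^ 5 = a} = ((Polynomial.nthRoots 5 a).toFinset : Set ℂ) := by
    ext t
    simp [Polynomial.mem_nthRoots]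
  rw [hset, Set.ncard_coe_finset, Multiset.toFinset_card_of_nodup (hζ.nthRoots_nodup ha),
    hζ.card_nthRoots, if_pos (IsAlgClosed.exists_pow_nat_eq a (by norm_num))]

theorem ncard_sq_add_self_eq_one : {φ : ℂ | φ ^ 2 + φ = 1}.ncard = 2 := by
  obtain ⟨s, hs⟩ := IsAlgClosed.exists_pow_nat_eq (5 : ℂ) (n := 2) (by norm_num)
  have hs0 : s ≠ 0 := by
    rintro rfl
    norm_num at hs
  have hset : {φ : ℂ | φ ^ 2 + φ = 1} = {(-1 + s) / 2, (-1 - s) / 2} := by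
    ext φ
    simp only [Set.mem_ofPred_eq, Set.mem_insert_iff, Set.mem_singleton_iff]
    rw [← sub_eq_zero (a := φ) (b := (-1 + s) / 2), ← sub_eq_zero (a := φ) (b := (-1 - s) / 2),
      ← mul_eq_zero, ← sub_eq_zero (b := (1 : ℂ))]
    have : (φ - (-1 + s) / 2) * (φ - (-1 - s) / 2) = φ ^ 2 + φ - 1 := by
      linear_combination -hs / 4
    rw [this]
  rw [hset, Set.ncard_pair]
  intro h
  apply hs0
  linear_combination h

/-- The critical points are parametrized by the pairs of a fifth root of `Q²` and a root
of `φ² + φ = 1`. -/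
theorem critical_set_eq_image (Q : ℂ) (hQ : Q ≠ 0) :
    {y : Fin 6 → ℂ | (∀ i, y i ≠ 0) ∧ (y 5 ^ 5 = Q ^ 2 ∧
      y 5 * y 3 ^ 2 + Q * y 3 - y 5 ^ 4 = 0 ∧
      y 4 = y 5 ^ 2 / y 3 ∧ y 0 = Q / y 5 ∧ y 1 = Q / y 4 ∧ y 2 = Q / y 3)} =
    poGr25Point Q '' ({t : ℂ | t ^ 5 = Q ^ 2} ×ˢ {φ : ℂ | φ ^ 2 + φ = 1}) := by
  ext y
  simp only [Set.mem_ofPred_eq, Set.mem_image, Set.mem_prod, Prod.exists]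
  constructor
  · rintro ⟨hy, q, r, e4, e0, e1, e2⟩
    have h3 := hy 3
    have h5 := hy 5
    refine ⟨y 5, y 5 * y 3 / Q, ⟨q, ?_⟩, ?_⟩
    · field_simp
      apply mul_left_cancel₀ h5
      linear_combination y 5 ^ 2 * r + y 5 * q
    · ext i
      fin_cases i
      · simp [poGr25Point, e0]
      · simp [poGr25Point, e1, e4]
        field_simp
      · simp [poGr25Point, e2]
        field_simp
      · simp [poGr25Point]
        field_simp
      · simp [poGr25Point, e4]
        field_simp
      · simp [poGr25Point]
  · rintro ⟨t, φ, ⟨ht, hφ⟩, rfl⟩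
    have ht0 : t ≠ 0 := by
      rintro rfl
      apply pow_ne_zero 2 hQ
      rw [← ht]
      norm_num
    have hφ0 : φ ≠ 0 := by
      rintro rfl
      norm_num at hφ
    refine ⟨fun i => ?_, ?_⟩
    · fin_cases i <;> simp [poGr25Point, ht0, hφ0, hQ]
    · simp only [poGr25Point, Matrix.cons_val]
      refine ⟨ht, ?_, ?_, trivial, ?_, ?_⟩
      · field_simp
        linear_combination Q ^ 2 * hφ - ht
      all_goals field_simp

theorem injOn_poGr25Point (Q : ℂ) (hQ : Q ≠ 0) :
    Set.InjOn (poGr25Point Q) ({t : ℂ | t ^ 5 = Q ^ 2} ×ˢ {φ : ℂ | φ ^ 2 + φ = 1}) := by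
  rintro ⟨t, φ⟩ ⟨ht, -⟩ ⟨t', φ'⟩ - h
  have h5 : t = t' := congrFun h 5
  have h3 : Q * φ / t = Q * φ' / t' := congrFun h 3
  have ht0 : t ≠ 0 := by
    rintro rfl
    apply pow_ne_zero 2 hQ
    rw [← show (0 : ℂ) ^ 5 = Q ^ 2 from ht]
    norm_num
  subst h5
  rw [div_left_inj' ht0] at h3
  rw [mul_left_cancel₀ hQ h3]

/-- Critical points of the `Gr(2,5)` potential: a point with nonzero coordinates is
critical iff `y₆⁵ = Q²`, `y₆y₄² + Qy₄ − y₆⁴ = 0`, `y₅ = y₆²/y₄`, `y₁ = Q/y₆`,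
`y₂ = Q/y₅`, `y₃ = Q/y₄`; and there are exactly ten critical points. -/
theorem stmt13 (Q : ℂ) (hQ : Q ≠ 0) :
    (∀ y : Fin 6 → ℂ, (∀ i, y i ≠ 0) →
      ((∀ i, deriv (fun w => poGr25 Q (Function.update y i w)) (y i) = 0) ↔
        (y 5) ^ 5 = Q ^ 2 ∧
        y 5 * (y 3) ^ 2 + Q * y 3 - (y 5) ^ 4 = 0 ∧
        y 4 = (y 5) ^ 2 / y 3 ∧
        y 0 = Q / y 5 ∧ y 1 = Q / y 4 ∧ y 2 = Q / y 3)) ∧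
    Set.ncard {y : Fin 6 → ℂ | (∀ i, y i ≠ 0) ∧
        ∀ i, deriv (fun w => poGr25 Q (Function.update y i w)) (y i) = 0} = 10 := by
  refine ⟨fun y hy => (poGr25_deriv_eq_zero_iff Q y hy).trans
    (poGr25_critical_relations_iff Q hQ y hy), ?_⟩
  have hset := Set.ext fun y : Fin 6 → ℂ =>
    and_congr_right fun hy : ∀ i, y i ≠ 0 => (poGr25_deriv_eq_zero_iff Q y hy).trans
      (poGr25_critical_relations_iff Q hQ y hy)
  refine (congrArg Set.ncard (hset.trans (critical_set_eq_image Q hQ))).trans ?_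
  rw [(injOn_poGr25Point Q hQ).ncard_image, Set.ncard_prod,
    ncard_fifth_roots (pow_ne_zero 2 hQ), ncard_sq_add_self_eq_one]
end

section
/- Let Q be a positive real number, let q = Q^{1/5} be its positive real fifth root, and let ζ = exp(2πi/5). For po: (ℂ∖{0})⁶ → ℂ defined by po(y₁,…,y₆) = Q/y₂ + y₂/y₁ + y₁/y₃ + y₂/y₄ + y₄/y₃ + y₃/y₅ + y₅ + y₄/y₆ + y₆/y₅, the set of critical values of po (values of po at points where all six partial complex derivatives vanish) equals { −5·(ζ^i + ζ^j)·q : 0 ≤ i < j ≤ 4 }. -/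
/-- A function of the form `w ↦ A + B * w + C / w` is stationary at `x ≠ 0` iff `B * x ^ 2 = C`. -/
lemma deriv_eq_zero_iff_of_eq_add_mul_add_div {f : ℂ → ℂ} {A B C x : ℂ} (hx : x ≠ 0)
    (hf : ∀ w, f w = A + B * w + C / w) : deriv f x = 0 ↔ B * x ^ 2 = C := by
  have h : HasDerivAt f (B - C / x ^ 2) x := by
    have h₁ := (((hasDerivAt_id x).const_mul B).const_add A).add
      ((hasDerivAt_inv hx).const_mul C)
    refine (h₁.congr_deriv (by ring)).congr_of_eventuallyEq
      (Filter.Eventually.of_forall fun w => ?_)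
    simp [hf w, div_eq_mul_inv]
  rw [h.deriv, sub_eq_zero, eq_div_iff (pow_ne_zero 2 hx)]

/-- The critical point equations of `poGr25`, with denominators cleared. -/
lemma poGr25_critical_iff (Q : ℂ) (y : Fin 6 → ℂ) (hy : ∀ i, y i ≠ 0) :
    (∀ i, deriv (fun w => poGr25 Q (Function.update y i w)) (y i) = 0) ↔
      y 0 ^ 2 = y 1 * y 2 ∧ (y 0 + y 3) * y 1 ^ 2 = Q * y 0 * y 3 ∧
      y 2 ^ 2 = (y 0 + y 3) * y 4 ∧ (y 2 + y 5) * y 3 ^ 2 = y 1 * y 2 * y 5 ∧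
      y 4 ^ 2 = y 2 + y 5 ∧ y 5 ^ 2 = y 3 * y 4 := by
  have h0 := hy 0
  have h1 := hy 1
  have h2 := hy 2
  have h3 := hy 3
  have h4 := hy 4
  have h5 := hy 5
  have e0 := deriv_eq_zero_iff_of_eq_add_mul_add_div
    (f := fun w => poGr25 Q (Function.update y 0 w)) (C := y 1) (B := 1 / y 2)
    (A := Q / y 1 + y 1 / y 3 + y 3 / y 2 + y 2 / y 4 + y 4 + y 3 / y 5 + y 5 / y 4)
    h0 (fun w => by simp [poGr25, Function.update]; ring)
  have e1 := deriv_eq_zero_iff_of_eq_add_mul_add_div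
    (f := fun w => poGr25 Q (Function.update y 1 w)) (C := Q) (B := 1 / y 0 + 1 / y 3)
    (A := y 0 / y 2 + y 3 / y 2 + y 2 / y 4 + y 4 + y 3 / y 5 + y 5 / y 4)
    h1 (fun w => by simp [poGr25, Function.update]; ring)
  have e2 := deriv_eq_zero_iff_of_eq_add_mul_add_div
    (f := fun w => poGr25 Q (Function.update y 2 w)) (C := y 0 + y 3) (B := 1 / y 4)
    (A := Q / y 1 + y 1 / y 0 + y 1 / y 3 + y 4 + y 3 / y 5 + y 5 / y 4)
    h2 (fun w => by simp [poGr25, Function.update]; ring)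
  have e3 := deriv_eq_zero_iff_of_eq_add_mul_add_div
    (f := fun w => poGr25 Q (Function.update y 3 w)) (C := y 1) (B := 1 / y 2 + 1 / y 5)
    (A := Q / y 1 + y 1 / y 0 + y 0 / y 2 + y 2 / y 4 + y 4 + y 5 / y 4)
    h3 (fun w => by simp [poGr25, Function.update]; ring)
  have e4 := deriv_eq_zero_iff_of_eq_add_mul_add_div
    (f := fun w => poGr25 Q (Function.update y 4 w)) (C := y 2 + y 5) (B := 1)
    (A := Q / y 1 + y 1 / y 0 + y 0 / y 2 + y 1 / y 3 + y 3 / y 2 + y 3 / y 5)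
    h4 (fun w => by simp [poGr25, Function.update]; ring)
  have e5 := deriv_eq_zero_iff_of_eq_add_mul_add_div
    (f := fun w => poGr25 Q (Function.update y 5 w)) (C := y 3) (B := 1 / y 4)
    (A := Q / y 1 + y 1 / y 0 + y 0 / y 2 + y 1 / y 3 + y 3 / y 2 + y 2 / y 4 + y 4)
    h5 (fun w => by simp [poGr25, Function.update]; ring)
  have all_iff : ∀ p : Fin 6 → Prop, (∀ i, p i) ↔ p 0 ∧ p 1 ∧ p 2 ∧ p 3 ∧ p 4 ∧ p 5 := fun p =>
    ⟨fun h => ⟨h 0, h 1, h 2, h 3, h 4, h 5⟩, fun ⟨a, b, c, d, e, f⟩ i => by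
      fin_cases i <;> assumption⟩
  rw [all_iff, e0, e1, e2, e3, e4, e5]
  refine and_congr ?_ (and_congr ?_ (and_congr ?_ (and_congr ?_ (and_congr ?_ ?_))))
  · rw [one_div_mul_eq_div, div_eq_iff h2]
  · rw [div_add_div _ _ h0 h3, div_mul_eq_mul_div, div_eq_iff (mul_ne_zero h0 h3)]
    constructor <;> intro h <;> linear_combination h
  · rw [one_div_mul_eq_div, div_eq_iff h4]
  · rw [div_add_div _ _ h2 h5, div_mul_eq_mul_div, div_eq_iff (mul_ne_zero h2 h5)]
    constructor <;> intro h <;> linear_combination h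
  · rw [one_mul]
  · rw [one_div_mul_eq_div, div_eq_iff h4]

/-- The value of the potential at a critical point, in terms of the parameters `e`, `u`, `t`. -/
lemma potential_value_eq {e u t : ℂ} (he : e ≠ 0) (hu : u ≠ 0) (ht : t ≠ 0) (h : e = t + u)
    (hut : e * u = t ^ 2) :
    t ^ 5 / (e * u ^ 2 * t) + e * u ^ 2 * t / (e * u * t) + e * u * t / (e * t) +
      e * u ^ 2 * t / (u ^ 2 * e) + u ^ 2 * e / (e * t) + e * t / e + e +
      u ^ 2 * e / (u * e) + u * e / e = 5 * e := by
  have h₁ : t ^ 5 / (e * u ^ 2 * t) = e := by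
    rw [div_eq_iff (by simp [he, hu, ht])]
    linear_combination -t * (e * u + t ^ 2) * hut
  have h₂ : u ^ 2 * e / (e * t) = t - u := by
    rw [div_eq_iff (mul_ne_zero he ht)]
    linear_combination e * hut - e * u * h
  have h₃ : e * u ^ 2 * t / (e * u * t) = u := by field_simp
  have h₄ : e * u * t / (e * t) = u := by field_simp
  have h₅ : e * u ^ 2 * t / (u ^ 2 * e) = t := by field_simp
  have h₆ : e * t / e = t := by field_simp
  have h₇ : u ^ 2 * e / (u * e) = u := by field_simp
  have h₈ : u * e / e = u := by field_simp
  rw [h₁, h₂, h₃, h₄, h₅, h₆, h₇, h₈]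
  linear_combination -3 * h

/-- The critical values of `poGr25` are the numbers `5 * e` with `e ^ 2 = t * e + t ^ 2` for some
fifth root `t` of `Q`. -/
lemma exists_poGr25_critical_iff {Q : ℂ} (hQ : Q ≠ 0) (v : ℂ) :
    (∃ y : Fin 6 → ℂ, (∀ i, y i ≠ 0) ∧
      (∀ i, deriv (fun w => poGr25 Q (Function.update y i w)) (y i) = 0) ∧ poGr25 Q y = v) ↔
      ∃ t e : ℂ, t ^ 5 = Q ∧ e ^ 2 = t * e + t ^ 2 ∧ v = 5 * e := by
  constructor
  · rintro ⟨y, hy, hcrit, rfl⟩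
    obtain ⟨ha, hb, hc, hd, he, hf⟩ := (poGr25_critical_iff Q y hy).1 hcrit
    have h0 := hy 0
    have h1 := hy 1
    have h2 := hy 2
    have h3 := hy 3
    have h4 := hy 4
    have h5 := hy 5
    unfold poGr25
    generalize y 0 = a at *
    generalize y 1 = b at *
    generalize y 2 = c at *
    generalize y 3 = d at *
    generalize y 4 = e at *
    generalize y 5 = f at *
    obtain ⟨u, rfl⟩ : ∃ u, f = u * e := ⟨f / e, by field_simp⟩
    have hu : u ≠ 0 := left_ne_zero_of_mul h5
    obtain rfl : d = u ^ 2 * e := mul_right_cancel₀ h4 (by linear_combination -hf)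
    obtain rfl : c = e * (e - u) := by linear_combination -he
    have ht : e - u ≠ 0 := right_ne_zero_of_mul h2
    obtain rfl : a = e ^ 2 * (e - 2 * u) := mul_right_cancel₀ h4 (by linear_combination -hc)
    have hb' : b * (e - u) = e ^ 3 * (e - 2 * u) ^ 2 :=
      mul_left_cancel₀ h4 (by linear_combination -ha)
    have hcub : u ^ 3 = e * (e - 2 * u) ^ 2 := by
      refine mul_left_cancel₀ (mul_ne_zero hu (pow_ne_zero 4 h4)) ?_
      linear_combination hd + u * e ^ 2 * hb'
    have hquad : e ^ 2 - 3 * e * u + u ^ 2 = 0 := by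
      refine (mul_eq_zero.1 ?_).resolve_left ht
      linear_combination -hcub
    obtain rfl : b = e * u ^ 2 * (e - u) := mul_right_cancel₀ ht (by
      linear_combination hb' - e ^ 2 * hcub - e * u ^ 2 * hquad)
    have ha' : e ^ 2 * (e - 2 * u) = e * u * (e - u) := by linear_combination e * hquad
    rw [ha'] at h0 hb ⊢
    have hQ' : Q = (e - u) ^ 5 := by
      refine mul_right_cancel₀ (mul_ne_zero h0 h3) ?_
      linear_combination -hb - e ^ 2 * u ^ 3 * (e - u) ^ 2 * ((e - u) ^ 2 + e * u) * hquad
    have hut : e * u = (e - u) ^ 2 := by linear_combination -hquad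
    refine ⟨e - u, e, hQ'.symm, by linear_combination -hquad, ?_⟩
    rw [hQ']
    exact potential_value_eq h4 hu ht (by ring) hut
  · rintro ⟨t, e, rfl, hte, rfl⟩
    have ht : t ≠ 0 := ne_zero_pow (by norm_num) hQ
    obtain ⟨u, rfl⟩ : ∃ u, t = e - u := ⟨e - t, by ring⟩
    have hut : e * u = (e - u) ^ 2 := by linear_combination hte
    have heu : e * u ≠ 0 := hut ▸ pow_ne_zero 2 ht
    have he : e ≠ 0 := left_ne_zero_of_mul heu
    have hu : u ≠ 0 := right_ne_zero_of_mul heu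
    have hy : ∀ i, ![e * u * (e - u), e * u ^ 2 * (e - u), e * (e - u), u ^ 2 * e, e, u * e] i ≠
        0 := by
      intro i
      fin_cases i <;> simp [he, hu, ht]
    refine ⟨_, hy, (poGr25_critical_iff _ _ hy).2 ?_, ?_⟩
    · refine ⟨?_, ?_, ?_, ?_, ?_, ?_⟩ <;> simp
      · ring
      · linear_combination e ^ 2 * u ^ 3 * (e - u) ^ 2 * (e * u + (e - u) ^ 2) * hut
      · linear_combination -e ^ 2 * hut
      · linear_combination e ^ 3 * u ^ 3 * hut
      · ring
      · ring
    · exact potential_value_eq he hu ht (by ring) hut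

/-- A sum of two fifth roots of unity with exponents distinct mod `5` has ordered exponents in
`0, …, 4`. -/
lemma exists_lt_pow_add_pow_eq {z : ℂ} (hz : z ^ 5 = 1) {m n : ℕ} (h : m % 5 ≠ n % 5) :
    ∃ i j : ℕ, i < j ∧ j ≤ 4 ∧ z ^ m + z ^ n = z ^ i + z ^ j := by
  rw [pow_eq_pow_mod m hz, pow_eq_pow_mod n hz]
  rcases lt_or_gt_of_ne h with h | h
  · exact ⟨_, _, h, by omega, rfl⟩
  · exact ⟨_, _, h, by omega, add_comm _ _⟩

/-- For positive real `Q` with positive fifth root `q`, the set of critical values of the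
`Gr(2,5)` potential function is `{−5(ζ⁵ⁱ + ζ⁵ʲ)q : 0 ≤ i < j ≤ 4}` with
`ζ = exp(2πi/5)`. -/
theorem stmt14 (Q q : ℝ) (hQ : 0 < Q) (hq : 0 < q) (hq5 : q ^ 5 = Q) :
    {v : ℂ | ∃ y : Fin 6 → ℂ, (∀ i, y i ≠ 0) ∧
        (∀ i, deriv (fun w => poGr25 (Q : ℂ) (Function.update y i w)) (y i) = 0) ∧
        poGr25 (Q : ℂ) y = v} =
      {v : ℂ | ∃ i j : ℕ, i < j ∧ j ≤ 4 ∧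
        v = -5 * (Complex.exp (2 * Real.pi * Complex.I / 5) ^ i +
                  Complex.exp (2 * Real.pi * Complex.I / 5) ^ j) * (q : ℂ)} := by
  have hz : IsPrimitiveRoot (Complex.exp (2 * Real.pi * Complex.I / 5)) 5 := by
    simpa using Complex.isPrimitiveRoot_exp 5 (by norm_num)
  generalize Complex.exp (2 * Real.pi * Complex.I / 5) = z at hz ⊢
  have hz5 : z ^ 5 = 1 := hz.pow_eq_one
  have hqC : (q : ℂ) ≠ 0 := by exact_mod_cast hq.ne'
  have hQq : (Q : ℂ) = (q : ℂ) ^ 5 := by exact_mod_cast hq5.symm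
  have hQC : (Q : ℂ) ≠ 0 := by exact_mod_cast hQ.ne'
  ext v
  simp only [Set.mem_ofPred_eq]
  rw [exists_poGr25_critical_iff hQC]
  constructor
  · rintro ⟨t, e, ht, he, rfl⟩
    obtain ⟨k, -, hk⟩ := hz.eq_pow_of_pow_eq_one (ξ := t / q) (by
      rw [div_pow, ht, hQq, div_self (pow_ne_zero 5 hqC)])
    obtain rfl : t = z ^ k * q := by rw [hk, div_mul_cancel₀ _ hqC]
    have hsum : 1 + z + z ^ 2 + z ^ 3 + z ^ 4 = 0 := by
      simpa [Finset.sum_range_succ] using hz.geom_sum_eq_zero (by norm_num)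
    have hfac : (e + z ^ k * q * (z ^ 2 + z ^ 3)) * (e + z ^ k * q * (z + z ^ 4)) = 0 := by
      linear_combination he + (z ^ k * q * e + (z ^ k * q) ^ 2) * hsum +
        (z ^ k * q) ^ 2 * (z + z ^ 2) * hz5
    rcases mul_eq_zero.1 hfac with h | h
    · obtain ⟨i, j, hij, hj, hs⟩ :=
        exists_lt_pow_add_pow_eq hz5 (m := k + 2) (n := k + 3) (by omega)
      exact ⟨i, j, hij, hj, by rw [← hs]; linear_combination 5 * h⟩
    · obtain ⟨i, j, hij, hj, hs⟩ :=
        exists_lt_pow_add_pow_eq hz5 (m := k + 1) (n := k + 4) (by omega)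
      exact ⟨i, j, hij, hj, by rw [← hs]; linear_combination 5 * h⟩
  · rintro ⟨i, j, hij, hj, rfl⟩
    have hne : z ^ i ≠ z ^ j := fun h => hij.ne (hz.pow_inj (by omega) (by omega) h)
    have hi5 : (z ^ i) ^ 5 = 1 := by rw [pow_right_comm, hz5, one_pow]
    have hj5 : (z ^ j) ^ 5 = 1 := by rw [pow_right_comm, hz5, one_pow]
    generalize z ^ i = w at *
    generalize z ^ j = x at *
    have hS : w ^ 4 + w ^ 3 * x + w ^ 2 * x ^ 2 + w * x ^ 3 + x ^ 4 = 0 := by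
      refine (mul_eq_zero.1 ?_).resolve_left (sub_ne_zero.2 hne)
      linear_combination hi5 - hj5
    refine ⟨(w * x) ^ 3 * q, -(w + x) * q, ?_, ?_, by ring⟩
    · rw [hQq]
      linear_combination (q : ℂ) ^ 5 * (x ^ 15 * (w ^ 10 + w ^ 5 + 1) * hi5 +
        (x ^ 10 + x ^ 5 + 1) * hj5)
    · linear_combination (q : ℂ) ^ 2 * (w ^ 2 * x * hS - (x ^ 2 + w * x + w * x ^ 6) * hi5 -
        (w ^ 2 + w * x) * hj5)
end

section
/- Let λ > 0 and 0 < t < s₂ < s₁ < λ. Let Z₀ be the 5×2 complex matrix with rows (√(t/λ), 0), (0, √(t/λ)), (√((s₂−t)(λ−s₁)/(λ(λ−s₂))), −√((λ−t)(s₁−s₂)/(λ(λ−s₂)))), (√((s₂−t)(s₁−s₂)/(λ(λ−s₂))), √((λ−t)(λ−s₁)/(λ(λ−s₂)))), (√((λ−s₂)/λ), 0), and set x₀ = λ·Z₀·Z₀ᴴ. Let K be the group of 5×5 unitary matrices of the block-diagonal form diag(P, e^{iθ₁}, e^{iθ₂}, 1) with P ∈ U(2) and θ₁, θ₂ ∈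 ℝ. Then the set of 5×5 complex Hermitian matrices x with characteristic polynomial X³(X−λ)², leading principal 2×2 submatrix x^(2) = t·I₂, characteristic polynomial of x^(3) equal to X(X−t)(X−s₁), and characteristic polynomial of x^(4) equal to X²(X−s₂)(X−λ), is exactly the orbit { k·x₀·kᴴ : k ∈ K }. -/
open Polynomial Matrix

open scoped ComplexOrder in
/-- A Hermitian matrix `A` with `A ^ 2 = c A` and rank `card m` is recovered from the columns
indexed by `e` as soon as the corresponding principal submatrix is a nonzero scalar. -/
theorem Matrix.IsHermitian.submatrix_mul_submatrix_eq_smul {n m : Type*} [Fintype n] [DecidableEq n]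
    [Fintype m] [DecidableEq m] [Nonempty m] {A : Matrix n n ℂ} (hA : A.IsHermitian) {c d : ℂ}
    (hAA : A * A = c • A) (htr : A.trace = c * Fintype.card m) (e : m → n)
    (he : A.submatrix e e = d • 1) :
    A.submatrix id e * A.submatrix e id = d • A := by
  set U := A.submatrix id e with hU
  set V := A.submatrix e id with hV
  have hUV : Uᴴ = V := by
    rw [hU, hV, conjTranspose_submatrix, hA.eq]
  have hVU' : Vᴴ = U := by rw [← hUV, conjTranspose_conjTranspose]
  have hAU : A * U = c • U := by
    have : A * U = (A * A).submatrix id e := by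
      ext i j; simp [hU, mul_apply]
    rw [this, hAA]; rfl
  have hVA : V * A = c • V := by
    have : V * A = (A * A).submatrix e id := by
      ext i j; simp [hV, mul_apply]
    rw [this, hAA]; rfl
  have hVU : V * U = (c * d) • 1 := by
    have : V * U = (A * A).submatrix e e := by
      ext i j; simp [hU, hV, mul_apply]
    rw [this, hAA, mul_smul, ← he]; rfl
  have hF : (U * V - d • A) * (U * V - d • A) = (-(c * d)) • (U * V - d • A) := by
    have h1 : U * V * (U * V) = (c * d) • (U * V) := by
      rw [Matrix.mul_assoc, ← Matrix.mul_assoc V, hVU]; simp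
    have h2 : U * V * A = c • (U * V) := by rw [Matrix.mul_assoc, hVA]; simp
    have h3 : A * (U * V) = c • (U * V) := by rw [← Matrix.mul_assoc, hAU]; simp
    simp only [sub_mul, mul_sub, h1, Matrix.smul_mul, Matrix.mul_smul, h2, h3, hAA]
    module
  have hFtr : (U * V - d • A).trace = 0 := by
    rw [trace_sub, trace_mul_comm, hVU, trace_smul, trace_smul, htr, trace_one]
    simp only [smul_eq_mul]; ring
  have hdreal : star d = d := by
    have := congr_fun₂ he (Classical.arbitrary m) (Classical.arbitrary m)
    simp only [submatrix_apply, smul_apply, one_apply_eq, smul_eq_mul, mul_one] at this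
    rw [← this]; exact hA.apply _ _
  have hFH : (U * V - d • A)ᴴ = U * V - d • A := by
    rw [conjTranspose_sub, conjTranspose_mul, hUV, hVU', conjTranspose_smul, hA.eq, hdreal]
  rw [← sub_eq_zero, ← trace_conjTranspose_mul_self_eq_zero_iff, hFH, hF, trace_smul, hFtr,
    smul_zero]

open scoped ComplexOrder in
/-- A Hermitian matrix with characteristic polynomial `X ^ 3 * (X - c) ^ 2` satisfies `A ^ 2 = c A`. -/
theorem Matrix.IsHermitian.mul_self_eq_smul_of_charpoly {n : Type*} [Fintype n] [DecidableEq n]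
    {A : Matrix n n ℂ} (hA : A.IsHermitian) {c : ℝ}
    (h : A.charpoly = X ^ 3 * (X - C (c : ℂ)) ^ 2) : A * A = (c : ℂ) • A := by
  have hch := aeval_self_charpoly A
  rw [h] at hch
  simp only [map_mul, map_pow, aeval_X, map_sub, aeval_C] at hch
  set N := A * (A - algebraMap ℂ _ (c : ℂ)) with hN
  have hcomm : Commute A (A - algebraMap ℂ _ (c : ℂ)) :=
    (Commute.refl A).sub_right (Algebra.commutes _ _).symm
  have hN4 : N ^ 4 = 0 := by
    rw [hN, hcomm.mul_pow, pow_succ' A 3, pow_add _ 2 2, Matrix.mul_assoc,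
      ← Matrix.mul_assoc (A ^ 3), hch]
    simp
  have hNH : Nᴴ = N := by
    rw [hN, conjTranspose_mul, conjTranspose_sub, hA.eq, hcomm.eq]
    simp [algebraMap_eq_diagonal, diagonal_conjTranspose, Pi.star_def, Pi.algebraMap_def]
  have hN2 : N * N = 0 := by
    rw [← conjTranspose_mul_self_eq_zero, conjTranspose_mul, hNH, ← hN4]
    noncomm_ring
  have hN0 : N = 0 := by rw [← conjTranspose_mul_self_eq_zero, hNH, hN2]
  rw [hN, mul_sub, sub_eq_zero] at hN0
  rw [hN0, Algebra.algebraMap_eq_smul_one]; simp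

/-- Two tall matrices `B₀`, `B` of size `3 × 2` with orthogonal columns of the same length and
with the same row norms agree up to row phases and a unitary change of columns. -/
theorem exists_diagonal_mul_eq_mul_unitary {B B₀ : Matrix (Fin 3) (Fin 2) ℂ} {c : ℝ} (hc : c ≠ 0)
    (hB : Bᴴ * B = (c : ℂ) • 1) (hB₀ : B₀ᴴ * B₀ = (c : ℂ) • 1)
    (hdiag : ∀ i, (B * Bᴴ) i i = (B₀ * B₀ᴴ) i i) (hne : ∀ i, (B₀ * B₀ᴴ) i i ≠ c) :
    ∃ P ∈ unitaryGroup (Fin 2) ℂ, ∃ θ₁ θ₂ : ℝ,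
      diagonal ![Complex.exp (θ₁ * Complex.I), Complex.exp (θ₂ * Complex.I), 1] * B₀ = B * P := by
  have key : ∀ M : Matrix (Fin 3) (Fin 2) ℂ, Mᴴ * M = (c : ℂ) • 1 →
      ∀ i j, ((c : ℂ) • (1 : Matrix (Fin 3) (Fin 3) ℂ) - M * Mᴴ) i 2 * star (((c : ℂ) • (1 : Matrix (Fin 3) (Fin 3) ℂ) - M * Mᴴ) j 2) =
        ((c : ℂ) • (1 : Matrix (Fin 3) (Fin 3) ℂ) - M * Mᴴ) 2 2 * ((c : ℂ) • (1 : Matrix (Fin 3) (Fin 3) ℂ) - M * Mᴴ) i j := by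
    intro M hM i j
    set R := (c : ℂ) • (1 : Matrix (Fin 3) (Fin 3) ℂ) - M * Mᴴ with hR
    have hRH : R.IsHermitian := by
      simp [IsHermitian, hR, conjTranspose_sub, conjTranspose_smul]
    have hsq : M * Mᴴ * (M * Mᴴ) = (c : ℂ) • (M * Mᴴ) := by
      rw [Matrix.mul_assoc, ← Matrix.mul_assoc Mᴴ, hM]; simp
    have hRR : R * R = (c : ℂ) • R := by
      simp only [hR, sub_mul, mul_sub, hsq, Matrix.smul_mul, Matrix.mul_smul, one_mul, mul_one]
      module
    have htr : R.trace = (c : ℂ) * Fintype.card (Fin 1) := by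
      rw [hR, trace_sub, trace_mul_comm, hM]
      simp; ring
    have h := hRH.submatrix_mul_submatrix_eq_smul hRR htr (d := R 2 2) (fun _ : Fin 1 => 2)
      (by ext a b; simp [Subsingleton.elim a b])
    have h := congr_fun (congr_fun h i) j
    simp [mul_apply] at h
    rw [hRH.apply]; exact h
  have hR := key B hB
  have hR₀ := key B₀ hB₀
  set R := (c : ℂ) • 1 - B * Bᴴ with hRdef
  set R₀ := (c : ℂ) • 1 - B₀ * B₀ᴴ with hR₀def
  have hRd : ∀ i, R i i = R₀ i i := fun i => by
    simp only [hRdef, hR₀def, Matrix.sub_apply, hdiag]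
  have hR₀d : ∀ i, R₀ i i ≠ 0 := fun i => by
    simpa [hR₀def, sub_eq_zero] using (hne i).symm
  have hR₀2 : ∀ i, R₀ i 2 ≠ 0 := fun i h => by
    have := hR₀ i i
    rw [h, zero_mul] at this
    exact mul_ne_zero (hR₀d 2) (hR₀d i) this.symm
  have hphase : ∀ i, ∃ θ : ℝ, R i 2 = Complex.exp (θ * Complex.I) * R₀ i 2 := fun i => by
    refine ⟨Complex.arg (R i 2 / R₀ i 2), ?_⟩
    have h1 : R i 2 * star (R i 2) = R₀ i 2 * star (R₀ i 2) := by
      rw [hR, hR₀, hRd, hRd]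
    have h2 : ‖R i 2‖ = ‖R₀ i 2‖ := by
      have : (‖R i 2‖ ^ 2 : ℂ) = (‖R₀ i 2‖ : ℂ) ^ 2 := by
        rw [← Complex.mul_conj', ← Complex.mul_conj']; exact h1
      have : ‖R i 2‖ ^ 2 = ‖R₀ i 2‖ ^ 2 := by exact_mod_cast this
      exact (sq_eq_sq₀ (norm_nonneg _) (norm_nonneg _)).1 this
    have h3 : ‖R i 2 / R₀ i 2‖ = 1 := by
      rw [norm_div, h2, div_self (norm_ne_zero_iff.2 (hR₀2 i))]
    have h4 := Complex.norm_mul_exp_arg_mul_I (R i 2 / R₀ i 2)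
    rw [h3, Complex.ofReal_one, one_mul] at h4
    rw [h4, div_mul_cancel₀ _ (hR₀2 i)]
  obtain ⟨θ₁, hθ₁⟩ := hphase 0
  obtain ⟨θ₂, hθ₂⟩ := hphase 1
  set u : Fin 3 → ℂ := ![Complex.exp (θ₁ * Complex.I), Complex.exp (θ₂ * Complex.I), 1] with hu
  have hRu : ∀ i, R i 2 = u i * R₀ i 2 := by
    intro i
    fin_cases i
    · exact hθ₁
    · exact hθ₂
    · simpa [hu] using hRd 2
  have huu : ∀ i, star (u i) * u i = 1 := by
    intro i
    fin_cases i <;> simp [hu, ← Complex.exp_conj, ← Complex.exp_add]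
  have hT : (diagonal u)ᴴ * diagonal u = 1 := by
    rw [diagonal_conjTranspose, diagonal_mul_diagonal, ← diagonal_one]
    congr 1; ext i; exact huu i
  have hT' : diagonal u * (diagonal u)ᴴ = 1 := mul_eq_one_comm.1 hT
  have hRR : R = diagonal u * R₀ * (diagonal u)ᴴ := by
    ext i j
    rw [diagonal_conjTranspose, mul_diagonal, diagonal_mul]
    apply mul_left_cancel₀ (hR₀d 2)
    have := hR i j
    rw [hRd, hRu, hRu, star_mul] at this
    rw [← this, Pi.star_apply]
    linear_combination (u i * star (u j)) * hR₀ i j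
  have hBB : B * Bᴴ = diagonal u * (B₀ * B₀ᴴ) * (diagonal u)ᴴ := by
    rw [hRdef, hR₀def, mul_sub, sub_mul] at hRR
    simp only [Matrix.mul_smul, Matrix.smul_mul, mul_one, hT'] at hRR
    exact sub_right_injective hRR
  have hc' : (c : ℂ) ≠ 0 := by exact_mod_cast hc
  have hBP : B * ((c : ℂ)⁻¹ • (Bᴴ * (diagonal u * B₀))) = diagonal u * B₀ := by
    rw [Matrix.mul_smul, ← Matrix.mul_assoc, hBB]
    have : diagonal u * (B₀ * B₀ᴴ) * (diagonal u)ᴴ * (diagonal u * B₀) =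
        diagonal u * (B₀ * (B₀ᴴ * (((diagonal u)ᴴ * diagonal u) * B₀))) := by
      simp only [Matrix.mul_assoc]
    rw [this, hT, Matrix.one_mul, hB₀, Matrix.mul_smul, Matrix.mul_one, Matrix.mul_smul, smul_smul,
      inv_mul_cancel₀ hc', one_smul]
  refine ⟨(c : ℂ)⁻¹ • (Bᴴ * (diagonal u * B₀)), ?_, θ₁, θ₂, hBP.symm⟩
  rw [mem_unitaryGroup_iff', star_eq_conjTranspose, conjTranspose_smul, conjTranspose_mul,
    conjTranspose_conjTranspose, Matrix.smul_mul, Matrix.mul_assoc, hBP, conjTranspose_mul,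
    Matrix.mul_assoc, ← Matrix.mul_assoc _ _ B₀, hT, Matrix.one_mul, hB₀,
    smul_smul, star_inv₀, RCLike.star_def, Complex.conj_ofReal, inv_mul_cancel₀ hc', one_smul]

theorem Matrix.charpoly_fin_two_eq {M : Matrix (Fin 2) (Fin 2) ℂ} {a b : ℂ}
    (htr : M.trace = a + b) (hdet : M.det = a * b) : M.charpoly = (X - C a) * (X - C b) := by
  rw [charpoly_fin_two, htr, hdet, C_add, C_mul]; ring

/-- Principal submatrices of `W * Wᴴ` have the spectrum of the corresponding Gram matrix of `W`,
up to zeros. -/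
theorem Matrix.charpoly_submatrix_smul_mul_conjTranspose {n : Type*} {k : ℕ}
    (W : Matrix n (Fin 2) ℂ) (c : ℂ) (e : Fin k → n) (hk : 2 ≤ k) :
    ((c • (W * Wᴴ)).submatrix e e).charpoly =
      X ^ (k - 2) * (c • ((W.submatrix e id)ᴴ * W.submatrix e id)).charpoly := by
  have h : (c • (W * Wᴴ)).submatrix e e = (c • W.submatrix e id) * (W.submatrix e id)ᴴ := by
    ext i j; simp [mul_apply, mul_add, mul_assoc]
  rw [h, charpoly_mul_comm_of_le _ _ (by simpa using hk), Matrix.mul_smul]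
  simp

/-- The element `diag(P, d)` of the block-diagonal subgroup. -/
def diagUnitary (P : Matrix (Fin 2) (Fin 2) ℂ) (d : Fin 3 → ℂ) : Matrix (Fin 5) (Fin 5) ℂ :=
  (reindex finSumFinEquiv finSumFinEquiv) (fromBlocks P 0 0 (diagonal d))

theorem diagUnitary_apply (P : Matrix (Fin 2) (Fin 2) ℂ) (d : Fin 3 → ℂ) (i j : Fin 2 ⊕ Fin 3) :
    diagUnitary P d (finSumFinEquiv i) (finSumFinEquiv j) = fromBlocks P 0 0 (diagonal d) i j :=
  congrArg₂ (fromBlocks P 0 0 (diagonal d)) (finSumFinEquiv.symm_apply_apply i)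
    (finSumFinEquiv.symm_apply_apply j)

theorem diagUnitary_mul_apply (P : Matrix (Fin 2) (Fin 2) ℂ) (d : Fin 3 → ℂ)
    (Z : Matrix (Fin 5) (Fin 2) ℂ) (i : Fin 2 ⊕ Fin 3) (a : Fin 2) :
    (diagUnitary P d * Z) (finSumFinEquiv i) a =
      ∑ j, fromBlocks P 0 0 (diagonal d) i j * Z (finSumFinEquiv j) a := by
  rw [mul_apply, ← (finSumFinEquiv (m := 2) (n := 3)).sum_comp]
  exact Finset.sum_congr rfl fun j _ => by rw [← diagUnitary_apply]

theorem diagUnitary_mul_castAdd (P : Matrix (Fin 2) (Fin 2) ℂ) (d : Fin 3 → ℂ)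
    (Z : Matrix (Fin 5) (Fin 2) ℂ) (i a : Fin 2) :
    (diagUnitary P d * Z) (Fin.castAdd 3 i) a = (P * Z.submatrix (Fin.castAdd 3) id) i a := by
  refine (diagUnitary_mul_apply P d Z (Sum.inl i) a).trans ?_
  rw [Fintype.sum_sum_type]
  simp only [fromBlocks_apply₁₁, fromBlocks_apply₁₂, Matrix.zero_apply, zero_mul,
    Finset.sum_const_zero, add_zero]
  rfl

theorem diagUnitary_mul_natAdd (P : Matrix (Fin 2) (Fin 2) ℂ) (d : Fin 3 → ℂ)
    (Z : Matrix (Fin 5) (Fin 2) ℂ) (i : Fin 3) (a : Fin 2) :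
    (diagUnitary P d * Z) (Fin.natAdd 2 i) a = d i * Z (Fin.natAdd 2 i) a := by
  refine (diagUnitary_mul_apply P d Z (Sum.inr i) a).trans ?_
  rw [Fintype.sum_sum_type]
  simp only [fromBlocks_apply₂₁, fromBlocks_apply₂₂, Matrix.zero_apply, zero_mul,
    Finset.sum_const_zero, zero_add, diagonal_apply, ite_mul, Finset.sum_ite_eq, Finset.mem_univ,
    if_true]
  rfl

/-- The shape of the base frame `Z₀`. -/
def baseFrame (p q r u v w : ℝ) : Matrix (Fin 5) (Fin 2) ℂ :=
  !![(p : ℂ), 0; 0, (p : ℂ); (q : ℂ), -(r : ℂ); (u : ℂ), (v : ℂ); (w : ℂ), 0]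

theorem baseFrame_gram {p q r u v w : ℝ}
    (hc₀ : p ^ 2 + q ^ 2 + u ^ 2 + w ^ 2 = 1) (hc₁ : p ^ 2 + r ^ 2 + v ^ 2 = 1)
    (horth : q * r = u * v) : (baseFrame p q r u v w)ᴴ * baseFrame p q r u v w = 1 := by
  have hc₀C : (p : ℂ) ^ 2 + q ^ 2 + u ^ 2 + w ^ 2 = 1 := by exact_mod_cast hc₀
  have hc₁C : (p : ℂ) ^ 2 + r ^ 2 + v ^ 2 = 1 := by exact_mod_cast hc₁
  have horthC : (q : ℂ) * r = u * v := by exact_mod_cast horth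
  ext a b
  fin_cases a <;> fin_cases b <;>
    simp [mul_apply, Fin.sum_univ_succ, baseFrame]
  · linear_combination hc₀C
  · linear_combination -horthC
  · linear_combination -horthC
  · linear_combination hc₁C

section Fiber

variable {lam s1 s2 t p q r u v w : ℝ}

theorem charpoly_of_mem_orbit
    (hp : lam * p ^ 2 = t) (hqr : lam * (q ^ 2 + r ^ 2) = s1 - t) (hw : lam * w ^ 2 = lam - s2)
    (hc₀ : p ^ 2 + q ^ 2 + u ^ 2 + w ^ 2 = 1) (hc₁ : p ^ 2 + r ^ 2 + v ^ 2 = 1)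
    (horth : q * r = u * v) {P : Matrix (Fin 2) (Fin 2) ℂ} (hP : P ∈ unitaryGroup (Fin 2) ℂ)
    {e₁ e₂ : ℂ} (he₁ : star e₁ * e₁ = 1) (he₂ : star e₂ * e₂ = 1)
    {W : Matrix (Fin 5) (Fin 2) ℂ} (hW : W = diagUnitary P ![e₁, e₂, 1] * baseFrame p q r u v w) :
    ((lam : ℂ) • (W * Wᴴ)).charpoly = X ^ 3 * (X - C (lam : ℂ)) ^ 2 ∧
      ((lam : ℂ) • (W * Wᴴ)).submatrix (Fin.castLE (by norm_num : 2 ≤ 5))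
        (Fin.castLE (by norm_num : 2 ≤ 5)) = (t : ℂ) • 1 ∧
      (((lam : ℂ) • (W * Wᴴ)).submatrix (Fin.castLE (by norm_num : 3 ≤ 5))
        (Fin.castLE (by norm_num : 3 ≤ 5))).charpoly = X * (X - C (t : ℂ)) * (X - C (s1 : ℂ)) ∧
      (((lam : ℂ) • (W * Wᴴ)).submatrix (Fin.castLE (by norm_num : 4 ≤ 5))
        (Fin.castLE (by norm_num : 4 ≤ 5))).charpoly =
          X ^ 2 * (X - C (s2 : ℂ)) * (X - C (lam : ℂ)) := by
  have hpC : (lam : ℂ) * p ^ 2 = t := by exact_mod_cast hp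
  have hqrC : (lam : ℂ) * (q ^ 2 + r ^ 2) = s1 - t := by exact_mod_cast hqr
  have hwC : (lam : ℂ) * w ^ 2 = lam - s2 := by exact_mod_cast hw
  have hc₀C : (p : ℂ) ^ 2 + q ^ 2 + u ^ 2 + w ^ 2 = 1 := by exact_mod_cast hc₀
  have hc₁C : (p : ℂ) ^ 2 + r ^ 2 + v ^ 2 = 1 := by exact_mod_cast hc₁
  have horthC : (q : ℂ) * r = u * v := by exact_mod_cast horth
  have hPP := mem_unitaryGroup_iff'.1 hP
  have hPP' := mem_unitaryGroup_iff.1 hP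
  have htop : ∀ i a : Fin 2, W (Fin.castAdd 3 i) a = p * P i a := by
    intro i a
    rw [hW, diagUnitary_mul_castAdd]
    fin_cases a <;> simp [mul_apply, baseFrame, Fin.sum_univ_two] <;> ring
  have hbot : ∀ (i : Fin 3) (a : Fin 2), W (Fin.natAdd 2 i) a =
      (![e₁, e₂, 1] : Fin 3 → ℂ) i * baseFrame p q r u v w (Fin.natAdd 2 i) a := by
    intro i a
    rw [hW, diagUnitary_mul_natAdd]
  have hPe : ∀ a b, star (W 0 a) * W 0 b + star (W 1 a) * W 1 b =
      p ^ 2 * (1 : Matrix (Fin 2) (Fin 2) ℂ) a b := by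
    intro a b
    have h0 : ∀ a, W 0 a = p * P 0 a := htop 0
    have h1 : ∀ a, W 1 a = p * P 1 a := htop 1
    rw [← hPP, h0, h0, h1, h1, mul_apply, Fin.sum_univ_two]
    simp only [star_apply, star_mul, RCLike.star_def, Complex.conj_ofReal]
    ring
  have hphase : ∀ (i : Fin 3) (a b : Fin 2), star (W (Fin.natAdd 2 i) a) * W (Fin.natAdd 2 i) b =
      star (baseFrame p q r u v w (Fin.natAdd 2 i) a) *
        baseFrame p q r u v w (Fin.natAdd 2 i) b := by
    intro i a b
    have hd : star ((![e₁, e₂, 1] : Fin 3 → ℂ) i) * (![e₁, e₂, 1] : Fin 3 → ℂ) i = 1 := by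
      fin_cases i
      · exact he₁
      · exact he₂
      · exact (by simp : star (1 : ℂ) * 1 = 1)
    rw [hbot, hbot, star_mul]
    linear_combination (star (baseFrame p q r u v w (Fin.natAdd 2 i) a) *
        baseFrame p q r u v w (Fin.natAdd 2 i) b) * hd
  have hrow2 : ∀ a b, star (W 2 a) * W 2 b =
      star (baseFrame p q r u v w 2 a) * baseFrame p q r u v w 2 b := hphase 0
  have hrow3 : ∀ a b, star (W 3 a) * W 3 b =
      star (baseFrame p q r u v w 3 a) * baseFrame p q r u v w 3 b := hphase 1
  have hrow4 : ∀ a b, star (W 4 a) * W 4 b =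
      star (baseFrame p q r u v w 4 a) * baseFrame p q r u v w 4 b := hphase 2
  have g3 : (W.submatrix (Fin.castLE (by norm_num : 3 ≤ 5)) id)ᴴ *
      W.submatrix (Fin.castLE (by norm_num : 3 ≤ 5)) id =
      !![(p : ℂ) ^ 2 + q ^ 2, -(q * r); -(q * r), p ^ 2 + r ^ 2] := by
    ext a b
    rw [mul_apply, Fin.sum_univ_three]
    change star (W 0 a) * W 0 b + star (W 1 a) * W 1 b + star (W 2 a) * W 2 b = _
    rw [hPe, hrow2]
    fin_cases a <;> fin_cases b <;> simp [baseFrame] <;> ring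
  have g4 : (W.submatrix (Fin.castLE (by norm_num : 4 ≤ 5)) id)ᴴ *
      W.submatrix (Fin.castLE (by norm_num : 4 ≤ 5)) id =
      !![(1 : ℂ) - w ^ 2, 0; 0, 1] := by
    ext a b
    rw [mul_apply, Fin.sum_univ_four]
    change star (W 0 a) * W 0 b + star (W 1 a) * W 1 b + star (W 2 a) * W 2 b +
      star (W 3 a) * W 3 b = _
    rw [hPe, hrow2, hrow3]
    fin_cases a <;> fin_cases b <;> simp [baseFrame]
    · linear_combination hc₀C
    · linear_combination -horthC
    · linear_combination -horthC
    · linear_combination hc₁C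
  have g5 : Wᴴ * W = 1 := by
    ext a b
    rw [mul_apply, Fin.sum_univ_five]
    change star (W 0 a) * W 0 b + star (W 1 a) * W 1 b + star (W 2 a) * W 2 b +
      star (W 3 a) * W 3 b + star (W 4 a) * W 4 b = _
    rw [hPe, hrow2, hrow3, hrow4]
    fin_cases a <;> fin_cases b <;> simp [baseFrame]
    · linear_combination hc₀C
    · linear_combination -horthC
    · linear_combination -horthC
    · linear_combination hc₁C
  refine ⟨?_, ?_, ?_, ?_⟩
  · have := charpoly_submatrix_smul_mul_conjTranspose W lam id (by norm_num)
    rw [submatrix_id_id, submatrix_id_id, g5] at this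
    rw [this, charpoly_fin_two_eq (a := lam) (b := lam)]
    · ring
    · simp; ring
    · simp; ring
  · ext i j
    have := congr_fun₂ hPP' i j
    simp only [mul_apply, Fin.sum_univ_two, star_apply] at this
    simp only [mul_apply, Fin.sum_univ_two, submatrix_apply, Matrix.smul_apply,
      conjTranspose_apply, smul_eq_mul]
    have h : ∀ i a, W (Fin.castLE (by norm_num : 2 ≤ 5) i) a = p * P i a := htop
    rw [h, h, h, h, ← this, ← hpC]
    simp only [star_mul, RCLike.star_def, Complex.conj_ofReal]
    ring
  · rw [charpoly_submatrix_smul_mul_conjTranspose W lam _ (by norm_num), g3,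
      charpoly_fin_two_eq (a := t) (b := s1)]
    · ring
    · simp [trace_fin_two]
      linear_combination 2 * hpC + hqrC
    · simp [det_fin_two]
      linear_combination (lam * p ^ 2 + lam * (q ^ 2 + r ^ 2) + t) * hpC + t * hqrC
  · rw [charpoly_submatrix_smul_mul_conjTranspose W lam _ (by norm_num), g4,
      charpoly_fin_two_eq (a := s2) (b := lam)]
    · ring
    · simp [trace_fin_two]
      linear_combination -hwC
    · simp only [det_smul, det_fin_two_of, Fintype.card_fin]
      linear_combination -lam * hwC

theorem exists_diagUnitary_of_mem_fiber (ht : 0 < t) (hts : t < s2) (hs : s2 < s1) (hsl : s1 < lam)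
    (hp : lam * p ^ 2 = t) (hqr : lam * (q ^ 2 + r ^ 2) = s1 - t) (hw : lam * w ^ 2 = lam - s2)
    (hc₀ : p ^ 2 + q ^ 2 + u ^ 2 + w ^ 2 = 1) (hc₁ : p ^ 2 + r ^ 2 + v ^ 2 = 1)
    (horth : q * r = u * v) {x : Matrix (Fin 5) (Fin 5) ℂ} (hx : x.IsHermitian)
    (hx5 : x.charpoly = X ^ 3 * (X - C (lam : ℂ)) ^ 2)
    (hx2 : x.submatrix (Fin.castLE (by norm_num : 2 ≤ 5)) (Fin.castLE (by norm_num : 2 ≤ 5)) =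
      (t : ℂ) • 1)
    (hx3 : (x.submatrix (Fin.castLE (by norm_num : 3 ≤ 5))
      (Fin.castLE (by norm_num : 3 ≤ 5))).charpoly = X * (X - C (t : ℂ)) * (X - C (s1 : ℂ)))
    (hx4 : (x.submatrix (Fin.castLE (by norm_num : 4 ≤ 5))
      (Fin.castLE (by norm_num : 4 ≤ 5))).charpoly =
        X ^ 2 * (X - C (s2 : ℂ)) * (X - C (lam : ℂ))) :
    ∃ P ∈ unitaryGroup (Fin 2) ℂ, ∃ θ₁ θ₂ : ℝ,
      x = diagUnitary P ![Complex.exp (θ₁ * Complex.I), Complex.exp (θ₂ * Complex.I), 1] *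
        ((lam : ℂ) • (baseFrame p q r u v w * (baseFrame p q r u v w)ᴴ)) *
        (diagUnitary P ![Complex.exp (θ₁ * Complex.I), Complex.exp (θ₂ * Complex.I), 1])ᴴ := by
  have hlam : 0 < lam := by linarith
  have hlC : (lam : ℂ) ≠ 0 := by exact_mod_cast hlam.ne'
  have htC : (t : ℂ) ≠ 0 := by exact_mod_cast ht.ne'
  have hpC : (lam : ℂ) * p ^ 2 = t := by exact_mod_cast hp
  have hqrC : (lam : ℂ) * (q ^ 2 + r ^ 2) = s1 - t := by exact_mod_cast hqr
  have hwC : (lam : ℂ) * w ^ 2 = lam - s2 := by exact_mod_cast hw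
  have hc₀C : (p : ℂ) ^ 2 + q ^ 2 + u ^ 2 + w ^ 2 = 1 := by exact_mod_cast hc₀
  have hc₁C : (p : ℂ) ^ 2 + r ^ 2 + v ^ 2 = 1 := by exact_mod_cast hc₁
  have hxx := hx.mul_self_eq_smul_of_charpoly hx5
  have tr5 : x.trace = 2 * lam := by
    rw [trace_eq_neg_charpoly_coeff, hx5, show (X ^ 3 * (X - C (lam : ℂ)) ^ 2 : ℂ[X]) =
      X ^ 5 - C (2 * (lam : ℂ)) * X ^ 4 + C ((lam : ℂ) ^ 2) * X ^ 3 by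
        simp only [C_mul, C_pow, C_ofNat]; ring]
    simp only [coeff_sub, coeff_add, coeff_C_mul, coeff_X_pow, Fintype.card_fin]
    norm_num
  have tr4 := trace_eq_neg_charpoly_coeff (x.submatrix (Fin.castLE (by norm_num : 4 ≤ 5))
      (Fin.castLE (by norm_num : 4 ≤ 5)))
  rw [hx4, show (X ^ 2 * (X - C (s2 : ℂ)) * (X - C (lam : ℂ)) : ℂ[X]) =
      X ^ 4 - C ((s2 : ℂ) + lam) * X ^ 3 + C ((s2 : ℂ) * lam) * X ^ 2 by
        simp only [C_mul, C_add]; ring] at tr4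
  have tr3 := trace_eq_neg_charpoly_coeff (x.submatrix (Fin.castLE (by norm_num : 3 ≤ 5))
      (Fin.castLE (by norm_num : 3 ≤ 5)))
  rw [hx3, show (X * (X - C (t : ℂ)) * (X - C (s1 : ℂ)) : ℂ[X]) =
      X ^ 3 - C ((t : ℂ) + s1) * X ^ 2 + C ((t : ℂ) * s1) * X by
        simp only [C_mul, C_add]; ring] at tr3
  have x00 : x 0 0 = t := by simpa using congr_fun₂ hx2 0 0
  have x11 : x 1 1 = t := by simpa using congr_fun₂ hx2 1 1
  have x22 : x 2 2 = s1 - t := by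
    simp only [coeff_sub, coeff_add, coeff_C_mul, coeff_X_pow, coeff_X, Fintype.card_fin] at tr3
    simp [trace, Fin.sum_univ_succ] at tr3
    linear_combination tr3 - x00 - x11
  have x33 : x 3 3 = lam + s2 - s1 - t := by
    simp only [coeff_sub, coeff_add, coeff_C_mul, coeff_X_pow, Fintype.card_fin] at tr4
    simp [trace, Fin.sum_univ_succ] at tr4
    linear_combination tr4 - x00 - x11 - x22
  have x44 : x 4 4 = lam - s2 := by
    simp [trace, Fin.sum_univ_succ] at tr5
    linear_combination tr5 - x00 - x11 - x22 - x33
  set e : Fin 2 → Fin 5 := Fin.castAdd 3 with he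
  have hxe : x.submatrix id e * x.submatrix e id = (t : ℂ) • x :=
    hx.submatrix_mul_submatrix_eq_smul hxx (by rw [tr5]; simp; ring) e hx2
  set Z : Matrix (Fin 5) (Fin 2) ℂ := ((p / t : ℝ) : ℂ) • x.submatrix id e with hZ
  have hZH : Zᴴ = ((p / t : ℝ) : ℂ) • x.submatrix e id := by
    rw [hZ, conjTranspose_smul, conjTranspose_submatrix, hx.eq, RCLike.star_def,
      Complex.conj_ofReal]
  have hscal : ((p / t : ℝ) : ℂ) * ((p / t : ℝ) : ℂ) * (lam * t) = 1 := by
    push_cast; field_simp; linear_combination hpC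
  have hZZ : (lam : ℂ) • (Z * Zᴴ) = x := by
    rw [hZH, hZ, Matrix.smul_mul, Matrix.mul_smul, hxe, smul_smul, smul_smul, smul_smul]
    rw [show (lam : ℂ) * ((p / t : ℝ) : ℂ) * ((p / t : ℝ) : ℂ) * t = 1 by
      linear_combination hscal, one_smul]
  have hZZ1 : Zᴴ * Z = 1 := by
    have : x.submatrix e id * x.submatrix id e = (x * x).submatrix e e := by
      ext i j; simp [mul_apply]
    rw [hZH, hZ, Matrix.smul_mul, Matrix.mul_smul, this, hxx]
    change _ • _ • (lam : ℂ) • x.submatrix e e = _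
    rw [show x.submatrix e e = (t : ℂ) • 1 from hx2, smul_smul, smul_smul, smul_smul,
      show ((p / t : ℝ) : ℂ) * ((p / t : ℝ) : ℂ) * lam * t = 1 by
      linear_combination hscal, one_smul]
  have hZtop : Z.submatrix e id = (p : ℂ) • 1 := by
    change ((p / t : ℝ) : ℂ) • x.submatrix e e = _
    rw [show x.submatrix e e = (t : ℂ) • 1 from hx2, smul_smul]
    push_cast
    rw [div_mul_cancel₀ _ htC]
  set Z₀ := baseFrame p q r u v w with hZ₀
  have hsplit : ∀ M : Matrix (Fin 5) (Fin 2) ℂ, Mᴴ * M =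
      (M.submatrix e id)ᴴ * M.submatrix e id +
        (M.submatrix (Fin.natAdd 2) id)ᴴ * M.submatrix (Fin.natAdd 2 : Fin 3 → Fin 5) id := by
    intro M
    ext i j
    simp only [Matrix.add_apply, mul_apply]
    exact Fin.sum_univ_add (a := 2) (b := 3) _
  have hZ₀top : Z₀.submatrix e id = (p : ℂ) • 1 := by
    ext i j; fin_cases i <;> fin_cases j <;> simp [hZ₀, baseFrame, he]
  have hZ₀1 : Z₀ᴴ * Z₀ = 1 := baseFrame_gram hc₀ hc₁ horth
  have hgram : ∀ M : Matrix (Fin 5) (Fin 2) ℂ, Mᴴ * M = 1 → M.submatrix e id = (p : ℂ) • 1 →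
      (M.submatrix (Fin.natAdd 2) id)ᴴ * M.submatrix (Fin.natAdd 2 : Fin 3 → Fin 5) id =
        ((1 - p ^ 2 : ℝ) : ℂ) • (1 : Matrix (Fin 2) (Fin 2) ℂ) := by
    intro M h1 h2
    have := hsplit M
    rw [h1, h2, conjTranspose_smul, conjTranspose_one, Matrix.smul_mul, Matrix.mul_smul,
      Matrix.one_mul, smul_smul, RCLike.star_def, Complex.conj_ofReal] at this
    rw [← sub_eq_iff_eq_add'] at this
    rw [← this]
    push_cast
    rw [sub_smul, one_smul, sq]
  have hZd : ∀ i : Fin 3, (Z.submatrix (Fin.natAdd 2) id *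
      (Z.submatrix (Fin.natAdd 2 : Fin 3 → Fin 5) id)ᴴ) i i =
        x (Fin.natAdd 2 i) (Fin.natAdd 2 i) / lam := by
    intro i
    rw [eq_div_iff hlC]
    conv_rhs => rw [← hZZ]
    simp [mul_apply]; ring
  have hZ₀d : ∀ i : Fin 3, (Z₀.submatrix (Fin.natAdd 2) id *
      (Z₀.submatrix (Fin.natAdd 2 : Fin 3 → Fin 5) id)ᴴ) i i =
        x (Fin.natAdd 2 i) (Fin.natAdd 2 i) / lam := by
    intro i
    rw [eq_div_iff hlC]
    fin_cases i <;> simp [mul_apply, Fin.sum_univ_two, hZ₀, baseFrame]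
    · linear_combination hqrC - x22
    · linear_combination lam * hc₀C + lam * hc₁C - 2 * hpC - hqrC - hwC - x33
    · linear_combination hwC - x44
  have hne : ∀ i : Fin 3, (Z₀.submatrix (Fin.natAdd 2) id *
      (Z₀.submatrix (Fin.natAdd 2 : Fin 3 → Fin 5) id)ᴴ) i i ≠ ((1 - p ^ 2 : ℝ) : ℂ) := by
    intro i h
    rw [hZ₀d, div_eq_iff hlC] at h
    have h' : x (Fin.natAdd 2 i) (Fin.natAdd 2 i) = ((lam - t : ℝ) : ℂ) := by
      rw [h]; push_cast; linear_combination -hpC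
    fin_cases i
    · have : s1 - t = lam - t :=
        Complex.ofReal_injective (by rw [← h', Complex.ofReal_sub]; exact x22.symm)
      linarith
    · have : lam + s2 - s1 - t = lam - t :=
        Complex.ofReal_injective (by rw [← h']; push_cast; exact x33.symm)
      linarith
    · have : lam - s2 = lam - t :=
        Complex.ofReal_injective (by rw [← h', Complex.ofReal_sub]; exact x44.symm)
      linarith
  have hcne : 1 - p ^ 2 ≠ 0 := by
    intro h
    have : lam * (1 - p ^ 2) = lam - t := by linear_combination -hp
    rw [h] at this; linarith
  obtain ⟨P, hP, θ₁, θ₂, hBP⟩ := exists_diagonal_mul_eq_mul_unitary hcne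
    (hgram Z hZZ1 hZtop) (hgram Z₀ hZ₀1 hZ₀top) (fun i => by rw [hZd, hZ₀d]) hne
  refine ⟨P, hP, θ₁, θ₂, ?_⟩
  set d : Fin 3 → ℂ := ![Complex.exp (θ₁ * Complex.I), Complex.exp (θ₂ * Complex.I), 1] with hd
  have hk : diagUnitary P d * Z₀ = Z * P := by
    ext i a
    refine Fin.addCases (m := 2) (n := 3) (fun i => ?_) (fun i => ?_) i
    · rw [diagUnitary_mul_castAdd]
      change (P * Z₀.submatrix e id) i a = (Z.submatrix e id * P) i a
      rw [hZ₀top, hZtop]; simp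
    · rw [diagUnitary_mul_natAdd]
      have := congr_fun₂ hBP i a
      rw [diagonal_mul] at this
      exact this
  have hPP : P * Pᴴ = 1 := mem_unitaryGroup_iff.1 hP
  calc x = (lam : ℂ) • (Z * (P * Pᴴ) * Zᴴ) := by rw [hPP, Matrix.mul_one, hZZ]
    _ = (lam : ℂ) • ((Z * P) * (Z * P)ᴴ) := by
      rw [conjTranspose_mul]; simp only [Matrix.mul_assoc]
    _ = _ := by
      rw [← hk, conjTranspose_mul, Matrix.mul_smul, Matrix.smul_mul]
      simp only [Matrix.mul_assoc]

end Fiber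

/-- The fiber `L₁(s₁,s₂,t)` of the Gelfand–Cetlin system on `Gr(2,5)` (characterized by
spectral data of leading principal submatrices) is exactly one orbit of the subgroup
`K = {diag(P, e^{iθ₁}, e^{iθ₂}, 1) : P ∈ U(2)} ≅ U(2)×T²` acting by conjugation on the
base point `x₀ = λ·Z₀·Z₀ᴴ`. -/
theorem stmt15 (lam s1 s2 t : ℝ)
    (h0 : 0 < t) (h1 : t < s2) (h2 : s2 < s1) (h3 : s1 < lam) :
    {x : Matrix (Fin 5) (Fin 5) ℂ | x.IsHermitian ∧
        x.charpoly = X ^ 3 * (X - C (lam : ℂ)) ^ 2 ∧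
        (x.submatrix (Fin.castLE (by norm_num)) (Fin.castLE (by norm_num)) :
            Matrix (Fin 2) (Fin 2) ℂ) = (t : ℂ) • 1 ∧
        (x.submatrix (Fin.castLE (by norm_num)) (Fin.castLE (by norm_num)) :
            Matrix (Fin 3) (Fin 3) ℂ).charpoly =
          X * (X - C (t : ℂ)) * (X - C (s1 : ℂ)) ∧
        (x.submatrix (Fin.castLE (by norm_num)) (Fin.castLE (by norm_num)) :
            Matrix (Fin 4) (Fin 4) ℂ).charpoly =
          X ^ 2 * (X - C (s2 : ℂ)) * (X - C (lam : ℂ))} =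
    {y : Matrix (Fin 5) (Fin 5) ℂ |
      ∃ P ∈ Matrix.unitaryGroup (Fin 2) ℂ, ∃ θ1 θ2 : ℝ,
        y = (Matrix.reindex finSumFinEquiv finSumFinEquiv)
              (Matrix.fromBlocks P 0 0
                (Matrix.diagonal
                  ![Complex.exp (θ1 * Complex.I), Complex.exp (θ2 * Complex.I), 1])) *
            ((lam : ℂ) •
              (!![(Real.sqrt (t / lam) : ℂ), 0;
                  0, (Real.sqrt (t / lam) : ℂ);
                  (Real.sqrt ((s2 - t) * (lam - s1) / (lam * (lam - s2))) : ℂ),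
                    -(Real.sqrt ((lam - t) * (s1 - s2) / (lam * (lam - s2))) : ℂ);
                  (Real.sqrt ((s2 - t) * (s1 - s2) / (lam * (lam - s2))) : ℂ),
                    (Real.sqrt ((lam - t) * (lam - s1) / (lam * (lam - s2))) : ℂ);
                  (Real.sqrt ((lam - s2) / lam) : ℂ), 0] *
                (!![(Real.sqrt (t / lam) : ℂ), 0;
                  0, (Real.sqrt (t / lam) : ℂ);
                  (Real.sqrt ((s2 - t) * (lam - s1) / (lam * (lam - s2))) : ℂ),
                    -(Real.sqrt ((lam - t) * (s1 - s2) / (lam * (lam - s2))) : ℂ);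
                  (Real.sqrt ((s2 - t) * (s1 - s2) / (lam * (lam - s2))) : ℂ),
                    (Real.sqrt ((lam - t) * (lam - s1) / (lam * (lam - s2))) : ℂ);
                  (Real.sqrt ((lam - s2) / lam) : ℂ), 0] : Matrix (Fin 5) (Fin 2) ℂ)ᴴ)) *
            ((Matrix.reindex finSumFinEquiv finSumFinEquiv)
              (Matrix.fromBlocks P 0 0
                (Matrix.diagonal
                  ![Complex.exp (θ1 * Complex.I), Complex.exp (θ2 * Complex.I), 1])))ᴴ} := by
  have hlam : 0 < lam := by linarith
  have hls : 0 < lam - s2 := by linarith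
  have hls₁ : 0 < lam - s1 := by linarith
  have hlt : 0 < lam - t := by linarith
  have hst : 0 < s2 - t := by linarith
  have hss : 0 < s1 - s2 := by linarith
  set p := √(t / lam) with hp_def
  set q := √((s2 - t) * (lam - s1) / (lam * (lam - s2))) with hq_def
  set r := √((lam - t) * (s1 - s2) / (lam * (lam - s2))) with hr_def
  set u := √((s2 - t) * (s1 - s2) / (lam * (lam - s2))) with hu_def
  set v := √((lam - t) * (lam - s1) / (lam * (lam - s2))) with hv_def
  set w := √((lam - s2) / lam) with hw_def
  have hp : p ^ 2 = t / lam := Real.sq_sqrt (by positivity)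
  have hq : q ^ 2 = (s2 - t) * (lam - s1) / (lam * (lam - s2)) := Real.sq_sqrt (by positivity)
  have hr : r ^ 2 = (lam - t) * (s1 - s2) / (lam * (lam - s2)) := Real.sq_sqrt (by positivity)
  have hu : u ^ 2 = (s2 - t) * (s1 - s2) / (lam * (lam - s2)) := Real.sq_sqrt (by positivity)
  have hv : v ^ 2 = (lam - t) * (lam - s1) / (lam * (lam - s2)) := Real.sq_sqrt (by positivity)
  have hw : w ^ 2 = (lam - s2) / lam := Real.sq_sqrt (by positivity)
  have horth : q * r = u * v := by
    rw [hq_def, hr_def, hu_def, hv_def, ← Real.sqrt_mul (by positivity),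
      ← Real.sqrt_mul (by positivity)]
    congr 1; ring
  have hp' : lam * p ^ 2 = t := by rw [hp]; field_simp
  have hqr' : lam * (q ^ 2 + r ^ 2) = s1 - t := by rw [hq, hr]; field_simp; ring
  have hw' : lam * w ^ 2 = lam - s2 := by rw [hw]; field_simp
  have hc₀ : p ^ 2 + q ^ 2 + u ^ 2 + w ^ 2 = 1 := by rw [hp, hq, hu, hw]; field_simp; ring
  have hc₁ : p ^ 2 + r ^ 2 + v ^ 2 = 1 := by rw [hp, hr, hv]; field_simp; ring
  ext x
  constructor
  · rintro ⟨hx, hx5, hx2, hx3, hx4⟩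
    exact exists_diagUnitary_of_mem_fiber h0 h1 h2 h3 hp' hqr' hw' hc₀ hc₁ horth hx hx5 hx2 hx3 hx4
  · rintro ⟨P, hP, θ₁, θ₂, hx⟩
    have hexp : ∀ θ : ℝ, star (Complex.exp (θ * Complex.I)) * Complex.exp (θ * Complex.I) = 1 :=
      fun θ => by simp [← Complex.exp_conj, ← Complex.exp_add]
    have hxW : x = (lam : ℂ) • ((diagUnitary P ![Complex.exp (θ₁ * Complex.I),
        Complex.exp (θ₂ * Complex.I), 1] * baseFrame p q r u v w) * (diagUnitary P
          ![Complex.exp (θ₁ * Complex.I), Complex.exp (θ₂ * Complex.I), 1] *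
            baseFrame p q r u v w)ᴴ) := by
      refine hx.trans ?_
      rw [conjTranspose_mul, Matrix.mul_smul, Matrix.smul_mul]
      simp only [Matrix.mul_assoc]
      rfl
    obtain ⟨hx5, hx2, hx3, hx4⟩ := charpoly_of_mem_orbit hp' hqr' hw' hc₀ hc₁ horth hP (hexp θ₁)
      (hexp θ₂) rfl
    rw [← hxW] at hx5 hx2 hx3 hx4
    refine ⟨?_, hx5, hx2, hx3, hx4⟩
    rw [hxW, IsHermitian, conjTranspose_smul, conjTranspose_mul, conjTranspose_conjTranspose,
      RCLike.star_def, Complex.conj_ofReal]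
end

section
/- Let λ > 0 and 0 < s₁ < s₂ < t < λ. Define L₂(s₁,s₂,t) as the set of 5×5 complex Hermitian matrices x with characteristic polynomial X³(X−λ)², entry x₁₁ = s₂, characteristic polynomial of x^(2) equal to (X−s₁)(X−t), characteristic polynomial of x^(3) equal to X(X−t)², and characteristic polynomial of x^(4) equal to X²(X−t)(X−λ). Define L₁(s₁',s₂',t') (for 0 < t' < s₂' < s₁' < λ) as the set of 5×5 Hermitian x with characteristic polynomial X³(X−λ)², x^(2) = t'·I₂, characteristic polynomial of x^(3) equal to X(X−t')(X−s₁'), and characteristic polynomial of x^(4) equal to X²(X−s₂')(X−λ). Let g be the 5×5 anti-diagonal permutation matrix with entries g_{i,6−i} = 1. Then { g·x·gᴴ : x ∈ L₂(s₁,s₂,t) } = L₁(λ−s₁, λ−s₂, λ−t). -/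
open Polynomial Matrix

/-- The Gelfand–Cetlin fiber `L₁(s₁,s₂,t)` on `Gr(2,5)`, for `0 < t < s₂ < s₁ < λ`,
described by spectral data of leading principal submatrices. -/
def L1set (lam s1 s2 t : ℝ) : Set (Matrix (Fin 5) (Fin 5) ℂ) :=
  {x | x.IsHermitian ∧
    x.charpoly = X ^ 3 * (X - C (lam : ℂ)) ^ 2 ∧
    (x.submatrix (Fin.castLE (by norm_num)) (Fin.castLE (by norm_num)) :
        Matrix (Fin 2) (Fin 2) ℂ) = (t : ℂ) • 1 ∧
    (x.submatrix (Fin.castLE (by norm_num)) (Fin.castLE (by norm_num)) :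
        Matrix (Fin 3) (Fin 3) ℂ).charpoly = X * (X - C (t : ℂ)) * (X - C (s1 : ℂ)) ∧
    (x.submatrix (Fin.castLE (by norm_num)) (Fin.castLE (by norm_num)) :
        Matrix (Fin 4) (Fin 4) ℂ).charpoly =
      X ^ 2 * (X - C (s2 : ℂ)) * (X - C (lam : ℂ))}

/-- The Gelfand–Cetlin fiber `L₂(s₁,s₂,t)` on `Gr(2,5)`, for `0 < s₁ < s₂ < t < λ`,
described by spectral data of leading principal submatrices. -/
def L2set (lam s1 s2 t : ℝ) : Set (Matrix (Fin 5) (Fin 5) ℂ) :=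
  {x | x.IsHermitian ∧
    x.charpoly = X ^ 3 * (X - C (lam : ℂ)) ^ 2 ∧
    x 0 0 = (s2 : ℂ) ∧
    (x.submatrix (Fin.castLE (by norm_num)) (Fin.castLE (by norm_num)) :
        Matrix (Fin 2) (Fin 2) ℂ).charpoly = (X - C (s1 : ℂ)) * (X - C (t : ℂ)) ∧
    (x.submatrix (Fin.castLE (by norm_num)) (Fin.castLE (by norm_num)) :
        Matrix (Fin 3) (Fin 3) ℂ).charpoly = X * (X - C (t : ℂ)) ^ 2 ∧
    (x.submatrix (Fin.castLE (by norm_num)) (Fin.castLE (by norm_num)) :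
        Matrix (Fin 4) (Fin 4) ℂ).charpoly =
      X ^ 2 * (X - C (t : ℂ)) * (X - C (lam : ℂ))}

/-- The order-reversing permutation matrix `g` (with `g_{i,6−i} = 1` in 1-based indexing). -/
def gperm : Matrix (Fin 5) (Fin 5) ℂ :=
  Matrix.of fun i j => if (i : ℕ) + (j : ℕ) = 4 then 1 else 0

open scoped ComplexOrder in
/-- A Hermitian matrix with characteristic polynomial `X ^ 3 * (X - lam) ^ 2`, `lam` real,
is `lam` times a projection. -/
theorem Matrix.IsHermitian.mul_self_eq_smul_of_charpoly_s16 {n : Type*} [Fintype n] [DecidableEq n]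
    {x : Matrix n n ℂ} (hx : x.IsHermitian) {lam : ℝ}
    (hc : x.charpoly = X ^ 3 * (X - C (lam : ℂ)) ^ 2) : x * x = (lam : ℂ) • x := by
  have hN : (x * x - (lam : ℂ) • x)ᴴ = x * x - (lam : ℂ) • x := by
    simp [conjTranspose_sub, conjTranspose_mul, conjTranspose_smul, hx.eq]
  have h := x.aeval_self_charpoly
  have hpoly : (X ^ 2 - C (lam : ℂ) * X) ^ 4
      = (X * (X - C (lam : ℂ)) ^ 2) * (X ^ 3 * (X - C (lam : ℂ)) ^ 2) := by ring
  have h4 := congrArg (aeval x) hpoly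
  rw [map_mul _ (X * (X - C (lam : ℂ)) ^ 2), ← hc, h, mul_zero] at h4
  have h4' : (x * x - (lam : ℂ) • x) ^ 4 = 0 := by
    simpa [sq x, ← Algebra.smul_def] using h4
  set N := x * x - (lam : ℂ) • x
  have h2 : N * N = 0 := by
    rw [← conjTranspose_mul_self_eq_zero, conjTranspose_mul, hN, ← h4']
    noncomm_ring
  have h1 : N = 0 := by
    rwa [← conjTranspose_mul_self_eq_zero, hN]
  exact sub_eq_zero.mp h1

open scoped ComplexOrder in
/-- A Hermitian `2 × 2` matrix with a real double eigenvalue is scalar. -/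
theorem Matrix.IsHermitian.eq_smul_one_of_charpoly {x : Matrix (Fin 2) (Fin 2) ℂ}
    (hx : x.IsHermitian) {c : ℝ} (hc : x.charpoly = (X - C (c : ℂ)) ^ 2) :
    x = (c : ℂ) • 1 := by
  have hN : (x - (c : ℂ) • 1)ᴴ = x - (c : ℂ) • 1 := by
    simp [conjTranspose_sub, conjTranspose_smul, hx.eq]
  have h := x.aeval_self_charpoly
  rw [hc] at h
  have h2 : (x - (c : ℂ) • 1) * (x - (c : ℂ) • 1) = 0 := by
    simpa [sq, Algebra.algebraMap_eq_smul_one] using h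
  refine sub_eq_zero.mp ?_
  rwa [← conjTranspose_mul_self_eq_zero, hN]

/-- The characteristic polynomials of complementary diagonal blocks of a matrix `x` with
`x * x = lam • x` determine each other. -/
theorem charpoly_mul_eval_complementary {k m : Type*} [Fintype k] [DecidableEq k]
    [Fintype m] [DecidableEq m] {lam : ℂ}
    (A : Matrix k k ℂ) (B : Matrix k m ℂ) (E : Matrix m k ℂ) (D : Matrix m m ℂ)
    (h : fromBlocks A B E D * fromBlocks A B E D = lam • fromBlocks A B E D) (z : ℂ) :
    (fromBlocks A B E D).charpoly.eval z * ((-1) ^ Fintype.card m * D.charpoly.eval (lam - z)) =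
      A.charpoly.eval z * (z * (z - lam)) ^ Fintype.card m := by
  rw [fromBlocks_multiply, fromBlocks_smul, fromBlocks_inj] at h
  obtain ⟨-, hB, -, hD⟩ := h
  have hneg : (-1) ^ Fintype.card m * D.charpoly.eval (lam - z)
      = ((z - lam) • (1 : Matrix m m ℂ) + D).det := by
    rw [eval_charpoly, ← det_neg, scalar_apply, ← smul_one_eq_diagonal]
    congr 1
    module
  have hprod : (z • 1 - fromBlocks A B E D) *
      fromBlocks 1 B 0 ((z - lam) • 1 + D) =
      fromBlocks (z • 1 - A) 0 (-E) ((z * (z - lam)) • 1) := by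
    have hsub : z • 1 - fromBlocks A B E D = fromBlocks (z • 1 - A) (-B) (-E) (z • 1 - D) := by
      rw [← fromBlocks_one, fromBlocks_smul, sub_eq_add_neg, fromBlocks_neg, fromBlocks_add]
      simp [sub_eq_add_neg]
    rw [hsub, fromBlocks_multiply]
    congr 1
    · simp
    · simp only [Matrix.neg_mul, Matrix.smul_mul, Matrix.one_mul, Matrix.mul_smul, Matrix.mul_one,
        Matrix.mul_add, Matrix.sub_mul]
      have := eq_sub_of_add_eq hB
      rw [this]
      module
    · simp
    · simp only [Matrix.neg_mul, Matrix.sub_mul, Matrix.mul_add,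
        Matrix.smul_mul, Matrix.one_mul, Matrix.mul_smul, Matrix.mul_one]
      have := eq_sub_of_add_eq hD
      rw [this]
      module
  have hdet := congrArg det hprod
  rw [det_mul, det_fromBlocks_zero₂₁, det_fromBlocks_zero₁₂, det_one, one_mul] at hdet
  rw [hneg, eval_charpoly, eval_charpoly, scalar_apply, scalar_apply, ← smul_one_eq_diagonal,
    ← smul_one_eq_diagonal, hdet, det_smul, det_one, mul_one]

/-- If `x` is Hermitian with characteristic polynomial `X ^ 3 * (X - lam) ^ 2`, the characteristic
polynomial of a diagonal block determines that of the complementary diagonal block. -/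
theorem charpoly_complementary {n k m : Type*} [Fintype n] [DecidableEq n] [Fintype k]
    [DecidableEq k] [Fintype m] [DecidableEq m] {x : Matrix n n ℂ} (hx : x.IsHermitian)
    {lam : ℝ} (hc : x.charpoly = X ^ 3 * (X - C (lam : ℂ)) ^ 2) (i : k → n) (j : m → n)
    (hij : Function.Bijective (Sum.elim i j)) {p q : ℂ[X]} (hp : (x.submatrix i i).charpoly = p)
    (hpq : p * (X * (X - C (lam : ℂ))) ^ Fintype.card m =
      X ^ 3 * (X - C (lam : ℂ)) ^ 2 *
        ((-1) ^ Fintype.card m * q.comp (C (lam : ℂ) - X))) :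
    (x.submatrix j j).charpoly = q := by
  let e : k ⊕ m ≃ n := Equiv.ofBijective _ hij
  have hblk : x.submatrix e e = fromBlocks (x.submatrix i i) (x.submatrix i j)
      (x.submatrix j i) (x.submatrix j j) := by
    ext (a | a) (b | b) <;> rfl
  have hsq : x.submatrix e e * x.submatrix e e = (lam : ℂ) • x.submatrix e e := by
    rw [submatrix_mul_equiv, hx.mul_self_eq_smul_of_charpoly_s16 hc]
    rfl
  have hce : (x.submatrix e e).charpoly = x.charpoly := by
    simpa [reindex_apply] using charpoly_reindex e.symm x
  rw [hblk] at hsq hce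
  have hcomp : (x.submatrix j j).charpoly.comp (C (lam : ℂ) - X) =
      q.comp (C (lam : ℂ) - X) := by
    have hne : (X ^ 3 * (X - C (lam : ℂ)) ^ 2) * (-1) ^ Fintype.card m ≠ 0 :=
      mul_ne_zero (mul_ne_zero (pow_ne_zero _ X_ne_zero) (pow_ne_zero _ (X_sub_C_ne_zero _)))
        (pow_ne_zero _ (by simp))
    refine mul_left_cancel₀ hne ?_
    rw [mul_assoc, mul_assoc _ _ (q.comp _), ← hpq, ← hp, ← hc, ← hce]
    refine Polynomial.funext fun z => ?_
    simpa using charpoly_mul_eval_complementary _ _ _ _ hsq z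
  have hinv : (C (lam : ℂ) - X).comp (C (lam : ℂ) - X) = X := by simp
  have := congrArg (fun r : ℂ[X] => r.comp (C (lam : ℂ) - X)) hcomp
  simpa only [comp_assoc, hinv, comp_X] using this

theorem gperm_mul_mul_conjTranspose (x : Matrix (Fin 5) (Fin 5) ℂ) :
    gperm * x * gpermᴴ = x.submatrix Fin.rev Fin.rev := by
  ext i j
  fin_cases i <;> fin_cases j <;>
    simp [gperm, Matrix.mul_apply, Fin.sum_univ_five, Fin.rev]

theorem charpoly_submatrix_rev {n : ℕ} (x : Matrix (Fin n) (Fin n) ℂ) :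
    (x.submatrix Fin.rev Fin.rev).charpoly = x.charpoly :=
  charpoly_reindex Fin.revPerm x

theorem charpoly_fin_one (M : Matrix (Fin 1) (Fin 1) ℂ) : M.charpoly = X - C (M 0 0) := by
  simp [charpoly, charmatrix]

theorem submatrix_rev_mem_L1set {lam s1 s2 t : ℝ} {x : Matrix (Fin 5) (Fin 5) ℂ}
    (hx : x ∈ L2set lam s1 s2 t) :
    x.submatrix Fin.rev Fin.rev ∈ L1set lam (lam - s1) (lam - s2) (lam - t) := by
  obtain ⟨hH, hc, e1, e2, e3, -⟩ := hx
  refine ⟨hH.submatrix _, (charpoly_submatrix_rev x).trans hc, ?_, ?_, ?_⟩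
  · refine ((hH.submatrix _).submatrix _).eq_smul_one_of_charpoly ?_
    rw [submatrix_submatrix]
    refine charpoly_complementary hH hc _ _ (by decide) e3 ?_
    simp
    ring
  · rw [submatrix_submatrix]
    refine charpoly_complementary hH hc _ _ (by decide) e2 ?_
    simp
    ring
  · rw [submatrix_submatrix]
    refine charpoly_complementary hH hc (fun _ : Fin 1 => 0) _ (by decide)
      (p := X - C (s2 : ℂ)) ?_ ?_
    · rw [charpoly_fin_one, submatrix_apply, e1]
    · simp
      ring

theorem submatrix_rev_mem_L2set {lam s1 s2 t : ℝ} {x : Matrix (Fin 5) (Fin 5) ℂ}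
    (hx : x ∈ L1set lam (lam - s1) (lam - s2) (lam - t)) :
    x.submatrix Fin.rev Fin.rev ∈ L2set lam s1 s2 t := by
  obtain ⟨hH, hc, e2, e3, e4⟩ := hx
  refine ⟨hH.submatrix _, (charpoly_submatrix_rev x).trans hc, ?_, ?_, ?_, ?_⟩
  · have h : (x.submatrix (fun _ : Fin 1 => 4) (fun _ : Fin 1 => 4)).charpoly =
        X - C (s2 : ℂ) := by
      refine charpoly_complementary hH hc _ _ (by decide) e4 ?_
      simp
      ring
    rw [charpoly_fin_one, sub_right_inj, C_inj] at h
    exact h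
  · rw [submatrix_submatrix]
    refine charpoly_complementary hH hc _ _ (by decide) e3 ?_
    simp
    ring
  · rw [submatrix_submatrix]
    refine charpoly_complementary hH hc _ _ (by decide)
      (p := (X - C ((lam - t : ℝ) : ℂ)) ^ 2) ((congrArg charpoly e2).trans ?_) ?_
    · rw [smul_one_eq_diagonal, charpoly_diagonal]
      simp
    · simp
      ring
  · rw [submatrix_submatrix]
    refine charpoly_complementary hH hc (fun _ : Fin 1 => 0) _ (by decide)
      (p := X - C ((lam - t : ℝ) : ℂ)) ?_ ?_
    · rw [charpoly_fin_one]
      have h00 : x 0 0 = ((lam - t : ℝ) : ℂ) := by simpa using congrFun (congrFun e2 0) 0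
      rw [submatrix_apply, h00]
    · simp
      ring

/-- Conjugation by the order-reversing permutation matrix carries the Gelfand–Cetlin
fiber `L₂(s₁,s₂,t)` of `Gr(2,5)` onto `L₁(λ−s₁, λ−s₂, λ−t)`. -/
theorem stmt16 (lam s1 s2 t : ℝ)
    (h0 : 0 < s1) (h1 : s1 < s2) (h2 : s2 < t) (h3 : t < lam) :
    (fun x : Matrix (Fin 5) (Fin 5) ℂ => gperm * x * gpermᴴ) '' L2set lam s1 s2 t =
      L1set lam (lam - s1) (lam - s2) (lam - t) := by
  simp only [gperm_mul_mul_conjTranspose]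
  refine Set.Subset.antisymm ?_ fun y hy => ⟨_, submatrix_rev_mem_L2set hy, ?_⟩
  · rintro _ ⟨x, hx, rfl⟩
    exact submatrix_rev_mem_L1set hx
  · ext i j
    simp
end

section
/- Let n ≥ 1, λ > 0 and t ∈ ℝ with 0 < |t| < λ, and let L_t be the set of 2n×2n complex matrices of the form [[t·Iₙ, √(λ²−t²)·Aᴴ], [√(λ²−t²)·A, −t·Iₙ]] with A ∈ U(n). For θ ∈ (0, π/2), let R_θ be the 2n×2n real matrix equal to the identity except for the entries (R_θ)_{1,1} = cos θ, (R_θ)_{1,n+1} = −sin θ, (R_θ)_{n+1,1} = sin θ, (R_θ)_{n+1,n+1} = cos θ. If |t|·tan θ > √(λ²−t²), then R_θ·x·R_θᵀ ∉ L_t for every x ∈ L_t; that is, (R_θ·L_t·R_θᵀ) ∩ L_t = ∅. -/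
open Matrix

/-- The rotation `R_θ = exp(θξ)`, acting in the plane of the first coordinates of the two
blocks, as a `2n×2n` (real-entried, complex) matrix. -/
noncomputable def Rrot (n : ℕ) (hn : 1 ≤ n) (θ : ℝ) :
    Matrix (Fin n ⊕ Fin n) (Fin n ⊕ Fin n) ℂ :=
  Matrix.of fun i j =>
    if i = Sum.inl (⟨0, hn⟩ : Fin n) ∧ j = Sum.inl (⟨0, hn⟩ : Fin n) then (Real.cos θ : ℂ)
    else if i = Sum.inl (⟨0, hn⟩ : Fin n) ∧ j = Sum.inr (⟨0, hn⟩ : Fin n) then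
      (-Real.sin θ : ℝ)
    else if i = Sum.inr (⟨0, hn⟩ : Fin n) ∧ j = Sum.inl (⟨0, hn⟩ : Fin n) then
      (Real.sin θ : ℂ)
    else if i = Sum.inr (⟨0, hn⟩ : Fin n) ∧ j = Sum.inr (⟨0, hn⟩ : Fin n) then
      (Real.cos θ : ℂ)
    else if i = j then 1 else 0

/-- Conjugation by the rotation only mixes the four entries in the plane it acts in. -/
lemma Rrot_conj_apply_inl_zero (n : ℕ) (hn : 1 ≤ n) (θ : ℝ)
    (x : Matrix (Fin n ⊕ Fin n) (Fin n ⊕ Fin n) ℂ) :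
    (Rrot n hn θ * x * (Rrot n hn θ)ᵀ) (Sum.inl ⟨0, hn⟩) (Sum.inl ⟨0, hn⟩) =
      (Real.cos θ : ℂ) ^ 2 * x (Sum.inl ⟨0, hn⟩) (Sum.inl ⟨0, hn⟩)
        - Real.cos θ * Real.sin θ * (x (Sum.inl ⟨0, hn⟩) (Sum.inr ⟨0, hn⟩)
          + x (Sum.inr ⟨0, hn⟩) (Sum.inl ⟨0, hn⟩))
        + (Real.sin θ : ℂ) ^ 2 * x (Sum.inr ⟨0, hn⟩) (Sum.inr ⟨0, hn⟩) := by
  have hl (j : Fin n) : Rrot n hn θ (Sum.inl ⟨0, hn⟩) (Sum.inl j) =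
      if j = ⟨0, hn⟩ then (Real.cos θ : ℂ) else 0 := by
    by_cases h : j = ⟨0, hn⟩
    · simp [Rrot, h]
    · simp [Rrot, h, Ne.symm h]
  have hr (j : Fin n) : Rrot n hn θ (Sum.inl ⟨0, hn⟩) (Sum.inr j) =
      if j = ⟨0, hn⟩ then -(Real.sin θ : ℂ) else 0 := by
    by_cases h : j = ⟨0, hn⟩ <;> simp [Rrot, h]
  simp only [Matrix.mul_apply, Matrix.transpose_apply, Fintype.sum_sum_type, hl, hr, ite_mul,
    mul_ite, zero_mul, mul_zero, Finset.sum_ite_eq', Finset.mem_univ, if_true]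
  ring

/-- If a point of `L_t` is rotated into `L_t`, then the real part of its corner entry is
`-t·tan θ`. -/
lemma sqrt_mul_re_eq_of_Rrot_conj_mem (n : ℕ) (hn : 1 ≤ n) (lam t θ : ℝ)
    (hs : Real.sin θ ≠ 0) (hc : Real.cos θ ≠ 0) (A : Matrix (Fin n) (Fin n) ℂ)
    (h : Rrot n hn θ * Matrix.fromBlocks ((t : ℂ) • 1) ((Real.sqrt (lam ^ 2 - t ^ 2) : ℂ) • Aᴴ)
      ((Real.sqrt (lam ^ 2 - t ^ 2) : ℂ) • A) ((-t : ℂ) • 1) * (Rrot n hn θ)ᵀ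
        ∈ GCfiber n lam t) :
    Real.sqrt (lam ^ 2 - t ^ 2) * (A ⟨0, hn⟩ ⟨0, hn⟩).re = -(t * Real.tan θ) := by
  obtain ⟨B, -, hB⟩ := h
  have key := congrArg Complex.re (congrFun (congrFun hB (Sum.inl ⟨0, hn⟩)) (Sum.inl ⟨0, hn⟩))
  rw [Rrot_conj_apply_inl_zero] at key
  simp only [Matrix.fromBlocks_apply₁₁, Matrix.fromBlocks_apply₁₂, Matrix.fromBlocks_apply₂₁,
    Matrix.fromBlocks_apply₂₂, Matrix.smul_apply, Matrix.one_apply_eq, smul_eq_mul, mul_one,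
    Matrix.conjTranspose_apply, ← mul_add, ← Complex.ofReal_pow, ← Complex.ofReal_mul,
    ← Complex.ofReal_neg, Complex.add_re, Complex.sub_re, Complex.re_ofReal_mul,
    Complex.ofReal_re, Complex.star_def, Complex.conj_re] at key
  rw [Real.tan_eq_sin_div_cos]
  field_simp
  apply mul_left_cancel₀ hs
  linear_combination -key / 2 + t / 2 * Real.sin_sq_add_cos_sq θ

/-- Displaceability of the Gelfand–Cetlin fiber `L_t ⊂ Gr(n,2n)` for `t ≠ 0`: if
`θ ∈ (0, π/2)` satisfies `|t|·tan θ > √(λ²−t²)`, then `R_θ·L_t·R_θᵀ` is disjoint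
from `L_t`. -/
theorem stmt17 (n : ℕ) (hn : 1 ≤ n) (lam t : ℝ) (hlam : 0 < lam)
    (ht0 : t ≠ 0) (ht : |t| < lam) (θ : ℝ) (hθ1 : 0 < θ) (hθ2 : θ < Real.pi / 2)
    (hdisp : |t| * Real.tan θ > Real.sqrt (lam ^ 2 - t ^ 2)) :
    ∀ x ∈ GCfiber n lam t, Rrot n hn θ * x * (Rrot n hn θ)ᵀ ∉ GCfiber n lam t := by
  rintro _ ⟨A, hA, rfl⟩ h
  have hs : 0 < Real.sin θ := Real.sin_pos_of_pos_of_lt_pi hθ1 (by linarith [Real.pi_pos])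
  have hc : 0 < Real.cos θ := Real.cos_pos_of_mem_Ioo ⟨by linarith, hθ2⟩
  have hre := sqrt_mul_re_eq_of_Rrot_conj_mem n hn lam t θ hs.ne' hc.ne' A h
  have hbound : |(A ⟨0, hn⟩ ⟨0, hn⟩).re| ≤ 1 :=
    (Complex.abs_re_le_norm _).trans (entry_norm_bound_of_unitary hA _ _)
  have habs := congrArg abs hre
  rw [abs_neg, abs_mul, abs_mul, abs_of_nonneg (Real.sqrt_nonneg _),
    abs_of_pos (Real.tan_pos_of_pos_of_lt_pi_div_two hθ1 hθ2)] at habs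
  linarith [mul_le_of_le_one_right (Real.sqrt_nonneg (lam ^ 2 - t ^ 2)) hbound]
end
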